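/- arXiv:1204.4026 — 15 statements merged into one kernel-verified Lean document; each statement's English description precedes it below -/
import Mathlib

section
/- Let f : ℂ^n → ℂ^n be a cubic-homogeneous mapping, i.e. f(x) = x − g(x,x,x) for some symmetric trilinear map g : ℂ^n × ℂ^n × ℂ^n → ℂ^n. Then there exist an integer N > n, an N×N complex matrix A, an n×N complex matrix B of full rank n, and an N×n complex matrix C, such that ker A = ker B (as subspaces of ℂ^N), B·C = I_n, and f(x) = B·F(C·x) for all x ∈ ℂ^n, where F : ℂ^N → ℂ^N is the cubic-linear map F(X) := X − (A·X)^{*3}. -/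
open Matrix

noncomputable section

/-- Componentwise (Hadamard) cube of a vector: `x^{*3}`. -/
def cube3 {m : ℕ} (v : Fin m → ℂ) : Fin m → ℂ := fun i => (v i) ^ 3

/-- The four linear forms `u ± v ± w` entering the polarization of the product `u * v * w`. -/
def polarizationForm {n : ℕ} (p : (Fin n × Fin n × Fin n) × Bool × Bool) : Fin n → ℂ :=
  Pi.single p.1.1 1 + (bif p.2.1 then 1 else -1 : ℂ) • Pi.single p.1.2.1 1 +
    (bif p.2.2 then 1 else -1 : ℂ) • Pi.single p.1.2.2 1

/-- The coefficient of the cube of `polarizationForm p` in the polarization of a product. -/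
def polarizationCoeff (p : Bool × Bool) : ℂ :=
  (bif p.1 then 1 else -1) * (bif p.2 then 1 else -1) / 24

/-- A cubic-homogeneous map is a linear combination of cubes of linear forms. -/
theorem trilinear_diag_eq_mulVec_cube {n : ℕ}
    (g : (Fin n → ℂ) →ₗ[ℂ] (Fin n → ℂ) →ₗ[ℂ] (Fin n → ℂ) →ₗ[ℂ] (Fin n → ℂ)) :
    ∃ (D : Matrix ((Fin n × Fin n × Fin n) × Bool × Bool) (Fin n) ℂ)
      (B : Matrix (Fin n) ((Fin n × Fin n × Fin n) × Bool × Bool) ℂ),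
      ∀ x, B *ᵥ (D *ᵥ x) ^ 3 = g x x x := by
  refine ⟨Matrix.of polarizationForm, Matrix.of fun m p => polarizationCoeff p.2 *
    g (Pi.single p.1.1 1) (Pi.single p.1.2.1 1) (Pi.single p.1.2.2 1) m, fun x => ?_⟩
  have hg : g x x x = ∑ i, ∑ j, ∑ k, (x i * x j * x k) •
      g (Pi.single i 1) (Pi.single j 1) (Pi.single k 1) := by
    have hexpand {M : Type} [AddCommMonoid M] [Module ℂ M] (L : (Fin n → ℂ) →ₗ[ℂ] M) :
        L x = ∑ i, x i • L (Pi.single i 1) := by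
      conv_lhs => rw [pi_eq_sum_univ' x, map_sum]
      simp only [map_smul]
    rw [hexpand g]
    simp only [LinearMap.sum_apply, LinearMap.smul_apply]
    refine Finset.sum_congr rfl fun i _ => ?_
    rw [hexpand (g (Pi.single i 1))]
    simp only [LinearMap.sum_apply, LinearMap.smul_apply, Finset.smul_sum]
    refine Finset.sum_congr rfl fun j _ => ?_
    rw [hexpand (g (Pi.single i 1) (Pi.single j 1))]
    simp only [Finset.smul_sum, smul_smul, mul_assoc]
  ext m
  rw [hg]
  simp only [mulVec, dotProduct, Finset.sum_apply, Pi.smul_apply, smul_eq_mul,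
    Fintype.sum_prod_type]
  refine Finset.sum_congr rfl fun i _ => Finset.sum_congr rfl fun j _ =>
    Finset.sum_congr rfl fun k _ => ?_
  have hform (a b : Bool) : ∑ l, polarizationForm ((i, j, k), a, b) l * x l =
      x i + (bif a then 1 else -1) * x j + (bif b then 1 else -1) * x k := by
    simp [polarizationForm, add_mul, Finset.sum_add_distrib, Pi.single_apply]
  simp only [Fintype.sum_bool, Pi.pow_apply, mulVec, dotProduct, of_apply, hform,
    polarizationCoeff, cond_true, cond_false]
  ring

/-- Appending the forms `±xᵢ`, whose cubes cancel, and a zero form makes both matrices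
have full rank without changing the represented map. -/
theorem exists_fullRank_cube_representation {n : ℕ} {κ : Type*} [Fintype κ]
    (D₀ : Matrix κ (Fin n) ℂ) (B₀ : Matrix (Fin n) κ ℂ) :
    ∃ (D C : Matrix (κ ⊕ Fin n ⊕ Fin n ⊕ Unit) (Fin n) ℂ)
      (B E : Matrix (Fin n) (κ ⊕ Fin n ⊕ Fin n ⊕ Unit) ℂ),
      E * D = 1 ∧ B * C = 1 ∧ ∀ x, B *ᵥ (D *ᵥ x) ^ 3 = B₀ *ᵥ (D₀ *ᵥ x) ^ 3 := by
  refine ⟨fromRows D₀ (fromRows 1 (fromRows (-1) 0)), fromRows 0 (fromRows 1 (fromRows 0 0)),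
    fromCols B₀ (fromCols 1 (fromCols 1 0)), fromCols 0 (fromCols 1 (fromCols 0 0)),
    ?_, ?_, fun x => ?_⟩
  · simp [fromCols_mul_fromRows]
  · simp [fromCols_mul_fromRows]
  · ext m
    have hodd : (-x m) ^ 3 = -x m ^ 3 := by ring
    simp only [fromRows_mulVec, one_mulVec, neg_mulVec, zero_mulVec]
    simp [mulVec, dotProduct, Matrix.one_apply, hodd]

/-- Every cubic-homogeneous map `f(x) = x - g(x,x,x)` can be paired to a
cubic-linear map `F(X) = X - (AX)^{*3}` in a higher dimension `N > n`,
through matrices `B` (full rank `n`, with `ker B = ker A`) and `C`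
(a right inverse of `B`), so that `f(x) = B·F(C·x)`. -/
theorem cubic_homogeneous_pairs_to_cubic_linear (n : ℕ)
    (f : (Fin n → ℂ) → (Fin n → ℂ))
    (g : (Fin n → ℂ) →ₗ[ℂ] (Fin n → ℂ) →ₗ[ℂ] (Fin n → ℂ) →ₗ[ℂ] (Fin n → ℂ))
    (hsymm : ∀ x y z, g x y z = g y x z ∧ g x y z = g x z y)
    (hf : ∀ x, f x = x - g x x x) :
    ∃ N : ℕ, n < N ∧
      ∃ (A : Matrix (Fin N) (Fin N) ℂ) (B : Matrix (Fin n) (Fin N) ℂ)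
        (C : Matrix (Fin N) (Fin n) ℂ),
        B.rank = n ∧
        LinearMap.ker A.mulVecLin = LinearMap.ker B.mulVecLin ∧
        B * C = 1 ∧
        ∀ x : Fin n → ℂ,
          f x = B.mulVec (C.mulVec x - cube3 (A.mulVec (C.mulVec x))) := by
  obtain ⟨D₀, B₀, h₀⟩ := trilinear_diag_eq_mulVec_cube g
  obtain ⟨D, C, B, E, hED, hBC, hB⟩ := exists_fullRank_cube_representation D₀ B₀
  have hcard : n < Fintype.card
      (((Fin n × Fin n × Fin n) × Bool × Bool) ⊕ Fin n ⊕ Fin n ⊕ Unit) := by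
    simp only [Fintype.card_sum, Fintype.card_fin, Fintype.card_unit]
    omega
  let e := (Fintype.equivFin
    (((Fin n × Fin n × Fin n) × Bool × Bool) ⊕ Fin n ⊕ Fin n ⊕ Unit)).symm
  have hBC' : B.submatrix id e * C.submatrix e id = 1 := by
    rw [submatrix_mul_equiv, hBC, submatrix_id_id]
  have hED' : E.submatrix id e * D.submatrix e id = 1 := by
    rw [submatrix_mul_equiv, hED, submatrix_id_id]
  refine ⟨_, hcard, D.submatrix e id * B.submatrix id e, B.submatrix id e, C.submatrix e id,
    ?_, ?_, hBC', fun x => ?_⟩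
  · apply le_antisymm (rank_le_height _)
    simpa [hBC'] using rank_mul_le_left (B.submatrix id e) (C.submatrix e id)
  · ext v
    simp only [LinearMap.mem_ker, mulVecLin_apply, ← mulVec_mulVec]
    refine ⟨fun h => ?_, fun h => by rw [h, mulVec_zero]⟩
    simpa [mulVec_mulVec, ← Matrix.mul_assoc, hED'] using
      congrArg (E.submatrix id e *ᵥ ·) h
  · have hcube : cube3 (D.submatrix e id *ᵥ x) = ((D *ᵥ x) ^ 3) ∘ e := rfl
    have hperm : B.submatrix id e *ᵥ (((D *ᵥ x) ^ 3) ∘ e) = B *ᵥ (D *ᵥ x) ^ 3 := by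
      simp [submatrix_mulVec_equiv, Function.comp_assoc]
    rw [mulVec_sub, mulVec_mulVec, mulVec_mulVec, Matrix.mul_assoc, hBC', one_mulVec,
      Matrix.mul_one, hcube, hperm, hB, h₀, hf]
end
end

section
/- Let A be a singular N×N complex matrix of rank n, F(X) := X − (A·X)^{*3}, and let B be an n×N complex matrix with ker B = ker A. If C and C̃ are two N×n complex matrices with B·C = I_n and B·C̃ = I_n, then B·F(C·x) = B·F(C̃·x) for all x ∈ ℂ^n; i.e. the paired map f(x) := B·F(C·x) does not depend on the choice of the right-inverse C of B. -/
open Matrix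

noncomputable section

/-- The paired map `f(x) := B·F(C·x)` does not depend on the choice of the
right inverse `C` of `B`. -/
theorem paired_map_independent_of_right_inverse (N n : ℕ) (hn : n < N)
    (A : Matrix (Fin N) (Fin N) ℂ) (hrank : A.rank = n)
    (F : (Fin N → ℂ) → (Fin N → ℂ))
    (hF : ∀ X, F X = X - cube3 (A.mulVec X))
    (B : Matrix (Fin n) (Fin N) ℂ)
    (hker : LinearMap.ker B.mulVecLin = LinearMap.ker A.mulVecLin)
    (C C' : Matrix (Fin N) (Fin n) ℂ)
    (hC : B * C = 1) (hC' : B * C' = 1) :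
    ∀ x : Fin n → ℂ, B.mulVec (F (C.mulVec x)) = B.mulVec (F (C'.mulVec x)) := by
  intro x
  have hBC : B.mulVec (C.mulVec x) = B.mulVec (C'.mulVec x) := by
    rw [mulVec_mulVec, mulVec_mulVec, hC, hC']
  have hmem : C.mulVec x - C'.mulVec x ∈ LinearMap.ker A.mulVecLin := by
    rw [← hker, LinearMap.mem_ker, mulVecLin_apply, mulVec_sub, hBC, sub_self]
  have hAC : A.mulVec (C.mulVec x) = A.mulVec (C'.mulVec x) := by
    rwa [LinearMap.mem_ker, mulVecLin_apply, mulVec_sub, sub_eq_zero] at hmem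
  rw [hF, hF, mulVec_sub, mulVec_sub, hBC, hAC]
end
end

section
/- Let A be a singular N×N complex matrix of rank n, F(X) := X − (A·X)^{*3}, let B be an n×N complex matrix with ker B = ker A, let C be an N×n matrix with B·C = I_n, and define f : ℂ^n → ℂ^n by f(x) := B·F(C·x). Then f(B·X) = B·F(X) for all X ∈ ℂ^N, i.e. B intertwines F and f. -/
open Matrix

noncomputable section

/-- `B` intertwines the cubic-linear map `F` and its paired map
`f(x) := B·F(C·x)`: one has `f(B·X) = B·F(X)` for all `X`. -/
theorem paired_map_intertwines (N n : ℕ) (hn : n < N)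
    (A : Matrix (Fin N) (Fin N) ℂ) (hrank : A.rank = n)
    (F : (Fin N → ℂ) → (Fin N → ℂ))
    (hF : ∀ X, F X = X - cube3 (A.mulVec X))
    (B : Matrix (Fin n) (Fin N) ℂ)
    (hker : LinearMap.ker B.mulVecLin = LinearMap.ker A.mulVecLin)
    (C : Matrix (Fin N) (Fin n) ℂ) (hC : B * C = 1)
    (f : (Fin n → ℂ) → (Fin n → ℂ))
    (hf : ∀ x, f x = B.mulVec (F (C.mulVec x))) :
    ∀ X : Fin N → ℂ, f (B.mulVec X) = B.mulVec (F X) := by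
  intro X
  have hBC : B.mulVec (C.mulVec (B.mulVec X)) = B.mulVec X := by
    rw [mulVec_mulVec, hC, one_mulVec]
  have hmem : C.mulVec (B.mulVec X) - X ∈ LinearMap.ker B.mulVecLin := by
    rw [LinearMap.mem_ker, mulVecLin_apply, mulVec_sub, hBC, sub_self]
  have hA : A.mulVec (C.mulVec (B.mulVec X)) = A.mulVec X := by
    rw [hker, LinearMap.mem_ker, mulVecLin_apply, mulVec_sub] at hmem
    exact sub_eq_zero.mp hmem
  rw [hf, hF, hF, hA, mulVec_sub, mulVec_sub, hBC]
end
end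

section
/- Let A be a singular N×N complex matrix of rank n, F(X) := X − (A·X)^{*3}, let B be an n×N complex matrix with ker B = ker A, let C be an N×n matrix with B·C = I_n, and define f : ℂ^n → ℂ^n by f(x) := B·F(C·x). Then det f′(x) = det F′(C·x) for all x ∈ ℂ^n, and det F′(X) = det f′(B·X) for all X ∈ ℂ^N. In particular, f has constant Jacobian determinant on ℂ^n if and only if F has constant Jacobian determinant on ℂ^N. -/
open Matrix

noncomputable section

/-- The Jacobian matrix of `X ↦ X - (A·X)^{*3}`. -/
def cubicJacobian {N : ℕ} (A : Matrix (Fin N) (Fin N) ℂ) (X : Fin N → ℂ) :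
    Matrix (Fin N) (Fin N) ℂ :=
  1 - Matrix.diagonal (fun i => 3 * (A.mulVec X i) ^ 2) * A

/-- Multiplication by a matrix as a continuous linear map. -/
def mulVecCLM {m n : ℕ} (M : Matrix (Fin m) (Fin n) ℂ) : (Fin n → ℂ) →L[ℂ] (Fin m → ℂ) :=
  LinearMap.toContinuousLinearMap M.mulVecLin

lemma mulVecCLM_apply {m n : ℕ} (M : Matrix (Fin m) (Fin n) ℂ) (v : Fin n → ℂ) :
    mulVecCLM M v = M.mulVec v := rfl

lemma det_mulVecCLM {n : ℕ} (M : Matrix (Fin n) (Fin n) ℂ) :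
    LinearMap.det (mulVecCLM M).toLinearMap = M.det :=
  LinearMap.det_toLin' M

lemma hasFDerivAt_cubicLinear {N : ℕ} (A : Matrix (Fin N) (Fin N) ℂ) (X : Fin N → ℂ) :
    HasFDerivAt (fun X => X - cube3 (A.mulVec X)) (mulVecCLM (cubicJacobian A X)) X := by
  rw [hasFDerivAt_pi']
  intro i
  have hA : HasFDerivAt (fun Y : Fin N → ℂ => A.mulVec Y i)
      ((ContinuousLinearMap.proj (R := ℂ) i).comp (mulVecCLM A)) X :=
    ((ContinuousLinearMap.proj (R := ℂ) i).comp (mulVecCLM A)).hasFDerivAt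
  refine ((hasFDerivAt_apply i X).sub (hA.pow 3)).congr_fderiv ?_
  ext v
  simp [mulVecCLM_apply, cubicJacobian, Matrix.sub_mulVec, ← Matrix.mulVec_mulVec,
    Matrix.mulVec_diagonal]

lemma mulVec_eq_of_ker_eq {N n : ℕ} {A : Matrix (Fin N) (Fin N) ℂ}
    {B : Matrix (Fin n) (Fin N) ℂ}
    (hker : LinearMap.ker B.mulVecLin = LinearMap.ker A.mulVecLin)
    {C : Matrix (Fin N) (Fin n) ℂ} (hC : B * C = 1) (X : Fin N → ℂ) :
    A.mulVec (C.mulVec (B.mulVec X)) = A.mulVec X := by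
  have h : C.mulVec (B.mulVec X) - X ∈ LinearMap.ker B.mulVecLin := by
    simp [Matrix.mulVec_sub, hC, Matrix.mulVec_mulVec, ← Matrix.mul_assoc]
  rw [hker] at h
  simpa [Matrix.mulVec_sub, sub_eq_zero] using h

/-- For paired maps `f(x) := B·F(C·x)` and `F(X) := X - (AX)^{*3}`,
the Jacobian determinants satisfy `det f′(x) = det F′(C·x)` and
`det F′(X) = det f′(B·X)`; in particular `f` has constant Jacobian
determinant iff `F` has. -/
theorem paired_map_jacobians (N n : ℕ) (hn : n < N)
    (A : Matrix (Fin N) (Fin N) ℂ) (hrank : A.rank = n)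
    (F : (Fin N → ℂ) → (Fin N → ℂ))
    (hF : ∀ X, F X = X - cube3 (A.mulVec X))
    (B : Matrix (Fin n) (Fin N) ℂ)
    (hker : LinearMap.ker B.mulVecLin = LinearMap.ker A.mulVecLin)
    (C : Matrix (Fin N) (Fin n) ℂ) (hC : B * C = 1)
    (f : (Fin n → ℂ) → (Fin n → ℂ))
    (hf : ∀ x, f x = B.mulVec (F (C.mulVec x))) :
    (∀ x : Fin n → ℂ,
        LinearMap.det (fderiv ℂ f x).toLinearMap =
          LinearMap.det (fderiv ℂ F (C.mulVec x)).toLinearMap) ∧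
    (∀ X : Fin N → ℂ,
        LinearMap.det (fderiv ℂ F X).toLinearMap =
          LinearMap.det (fderiv ℂ f (B.mulVec X)).toLinearMap) ∧
    ((∃ c : ℂ, ∀ x : Fin n → ℂ, LinearMap.det (fderiv ℂ f x).toLinearMap = c) ↔
      (∃ c : ℂ, ∀ X : Fin N → ℂ, LinearMap.det (fderiv ℂ F X).toLinearMap = c)) := by
  have hFd : ∀ X, fderiv ℂ F X = mulVecCLM (cubicJacobian A X) := fun X => by
    rw [funext hF]
    exact (hasFDerivAt_cubicLinear A X).fderiv
  have hfd : ∀ x, fderiv ℂ f x = mulVecCLM (B * cubicJacobian A (C.mulVec x) * C) := fun x => by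
    have hFC : HasFDerivAt F (mulVecCLM (cubicJacobian A (C.mulVec x))) (mulVecCLM C x) := by
      rw [funext hF]
      exact hasFDerivAt_cubicLinear A _
    have h := (mulVecCLM B).hasFDerivAt.comp x (hFC.comp x (mulVecCLM C).hasFDerivAt)
    have hfun : f = mulVecCLM B ∘ F ∘ mulVecCLM C := funext hf
    rw [hfun, h.fderiv]
    ext1 v
    simp [mulVecCLM_apply, Matrix.mulVec_mulVec, Matrix.mul_assoc]
  have hACB : A * C * B = A := by
    refine Matrix.ext_of_mulVec_single fun i => ?_
    rw [← Matrix.mulVec_mulVec, ← Matrix.mulVec_mulVec]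
    exact mulVec_eq_of_ker_eq hker hC (Pi.single i 1)
  have h₁ : ∀ x, LinearMap.det (fderiv ℂ f x).toLinearMap =
      LinearMap.det (fderiv ℂ F (C.mulVec x)).toLinearMap := fun x => by
    rw [hfd, hFd, det_mulVecCLM, det_mulVecCLM, cubicJacobian]
    set D := Matrix.diagonal fun i => 3 * (A.mulVec (C.mulVec x) i) ^ 2
    calc (B * (1 - D * A) * C).det = (1 - B * (D * A * C)).det := by
          rw [Matrix.mul_sub, Matrix.sub_mul, Matrix.mul_one, hC]
          simp only [Matrix.mul_assoc]
      _ = (1 - D * A * C * B).det := Matrix.det_one_sub_mul_comm _ _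
      _ = (1 - D * A).det := by
          rw [Matrix.mul_assoc D, Matrix.mul_assoc D, hACB]
  have h₂ : ∀ X, LinearMap.det (fderiv ℂ F X).toLinearMap =
      LinearMap.det (fderiv ℂ f (B.mulVec X)).toLinearMap := fun X => by
    rw [h₁, hFd, hFd, cubicJacobian, cubicJacobian, mulVec_eq_of_ker_eq hker hC]
  exact ⟨h₁, h₂, fun ⟨c, hc⟩ => ⟨c, fun X => (h₂ X).trans (hc _)⟩,
    fun ⟨c, hc⟩ => ⟨c, fun x => (h₁ x).trans (hc _)⟩⟩
end
end

section
/- Let A be a singular N×N complex matrix of rank n, F(X) := X − (A·X)^{*3}, let B be an n×N complex matrix with ker B = ker A, let C be an N×n matrix with B·C = I_n, and define f : ℂ^n → ℂ^n by f(x) := B·F(C·x). If F is injective, then f is injective; if F is surjective, then f is surjective; and if F is bijective, then f is bijective with f⁻¹(y) = B·F⁻¹(C·y) for all y ∈ ℂ^n. -/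
open Matrix

noncomputable section

/-- Adding a kernel vector of `A` to the argument of `X - (A·X)^{*3}` adds it to the value. -/
theorem add_sub_cube3_mulVec_of_mulVec_eq_zero {N : ℕ} (A : Matrix (Fin N) (Fin N) ℂ)
    (X k : Fin N → ℂ) (hk : A.mulVec k = 0) :
    X + k - cube3 (A.mulVec (X + k)) = X - cube3 (A.mulVec X) + k := by
  rw [mulVec_add, hk, add_zero, add_sub_right_comm]

/-- If the cubic-linear map `F` is injective (resp. surjective, bijective),
then so is its paired map `f(x) := B·F(C·x)`; when `F` is bijective,
`f⁻¹(y) = B·F⁻¹(C·y)`. -/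
theorem paired_map_inherits_invertibility_from_F (N n : ℕ) (hn : n < N)
    (A : Matrix (Fin N) (Fin N) ℂ) (hrank : A.rank = n)
    (F : (Fin N → ℂ) → (Fin N → ℂ))
    (hF : ∀ X, F X = X - cube3 (A.mulVec X))
    (B : Matrix (Fin n) (Fin N) ℂ)
    (hker : LinearMap.ker B.mulVecLin = LinearMap.ker A.mulVecLin)
    (C : Matrix (Fin N) (Fin n) ℂ) (hC : B * C = 1)
    (f : (Fin n → ℂ) → (Fin n → ℂ))
    (hf : ∀ x, f x = B.mulVec (F (C.mulVec x))) :
    (Function.Injective F → Function.Injective f) ∧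
    (Function.Surjective F → Function.Surjective f) ∧
    (Function.Bijective F → Function.Bijective f ∧
      ∀ y : Fin n → ℂ,
        Function.invFun f y = B.mulVec (Function.invFun F (C.mulVec y))) := by
  have hker' : ∀ k, B.mulVec k = 0 ↔ A.mulVec k = 0 := fun k => by
    simpa using SetLike.ext_iff.mp hker k
  have hBC : ∀ x, B.mulVec (C.mulVec x) = x := fun x => by
    rw [mulVec_mulVec, hC, one_mulVec]
  have hFadd : ∀ X k, B.mulVec k = 0 → F (X + k) = F X + k := fun X k hk => by
    rw [hF, hF, add_sub_cube3_mulVec_of_mulVec_eq_zero A X k ((hker' k).mp hk)]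
  have hsemi : ∀ X, f (B.mulVec X) = B.mulVec (F X) := fun X => by
    have hk : B.mulVec (C.mulVec (B.mulVec X) - X) = 0 := by
      rw [mulVec_sub, hBC, sub_self]
    have h := hFadd X _ hk
    rw [add_sub_cancel] at h
    rw [hf, h, mulVec_add, hk, add_zero]
  have hinj : Function.Injective F → Function.Injective f := fun hFi x x' hxx' => by
    have hk : B.mulVec (F (C.mulVec x) - F (C.mulVec x')) = 0 := by
      rw [mulVec_sub, ← hf, ← hf, hxx', sub_self]
    have h := hFadd (C.mulVec x') _ hk
    rw [add_sub_cancel] at h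
    rw [← hBC x, ← hFi h, mulVec_add, hk, add_zero, hBC]
  have hsurj : Function.Surjective F → Function.Surjective f := fun hFs y => by
    obtain ⟨X, hX⟩ := hFs (C.mulVec y)
    exact ⟨B.mulVec X, by rw [hsemi, hX, hBC]⟩
  refine ⟨hinj, hsurj, fun hFb => ⟨⟨hinj hFb.1, hsurj hFb.2⟩, fun y => hinj hFb.1 ?_⟩⟩
  rw [Function.invFun_eq (hsurj hFb.2 y), hsemi, Function.invFun_eq (hFb.2 _), hBC]
end
end

section
/- Let A be a singular N×N complex matrix of rank n, F(X) := X − (A·X)^{*3}, let B be an n×N complex matrix with ker B = ker A, let C be an N×n matrix with B·C = I_n, and define f : ℂ^n → ℂ^n by f(x) := B·F(C·x). If f is injective, then F is injective; if f is surjective, then F is surjective; and if f is bijective, then F is bijective with F⁻¹(Y) = Y + (A·C·f⁻¹(B·Y))^{*3} = Y − F(C·f⁻¹(B·Y)) + C·f⁻¹(B·Y) for all Y ∈ ℂ^N. -/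
open Matrix

noncomputable section

/-- If the paired map `f(x) := B·F(C·x)` is injective (resp. surjective,
bijective), then so is the cubic-linear map `F`; when `f` is bijective,
`F⁻¹(Y) = Y + (A·C·f⁻¹(B·Y))^{*3} = Y − F(C·f⁻¹(B·Y)) + C·f⁻¹(B·Y)`. -/
theorem paired_map_inherits_invertibility_from_f (N n : ℕ) (hn : n < N)
    (A : Matrix (Fin N) (Fin N) ℂ) (hrank : A.rank = n)
    (F : (Fin N → ℂ) → (Fin N → ℂ))
    (hF : ∀ X, F X = X - cube3 (A.mulVec X))
    (B : Matrix (Fin n) (Fin N) ℂ)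
    (hker : LinearMap.ker B.mulVecLin = LinearMap.ker A.mulVecLin)
    (C : Matrix (Fin N) (Fin n) ℂ) (hC : B * C = 1)
    (f : (Fin n → ℂ) → (Fin n → ℂ))
    (hf : ∀ x, f x = B.mulVec (F (C.mulVec x))) :
    (Function.Injective f → Function.Injective F) ∧
    (Function.Surjective f → Function.Surjective F) ∧
    (Function.Bijective f → Function.Bijective F ∧
      ∀ Y : Fin N → ℂ,
        Function.invFun F Y =
          Y + cube3 (A.mulVec (C.mulVec (Function.invFun f (B.mulVec Y)))) ∧
        Function.invFun F Y =
          Y - F (C.mulVec (Function.invFun f (B.mulVec Y)))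
            + C.mulVec (Function.invFun f (B.mulVec Y))) := by
  have hACB : ∀ X, A.mulVec (C.mulVec (B.mulVec X)) = A.mulVec X := by
    intro X
    have hmem : C.mulVec (B.mulVec X) - X ∈ LinearMap.ker A.mulVecLin := by
      rw [← hker, LinearMap.mem_ker, Matrix.mulVecLin_apply, Matrix.mulVec_sub,
        Matrix.mulVec_mulVec, hC, Matrix.one_mulVec, sub_self]
    rw [LinearMap.mem_ker, Matrix.mulVecLin_apply, Matrix.mulVec_sub] at hmem
    exact sub_eq_zero.mp hmem
  have hf' : ∀ x, f x = x - B.mulVec (cube3 (A.mulVec (C.mulVec x))) := by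
    intro x
    rw [hf, hF, Matrix.mulVec_sub, Matrix.mulVec_mulVec, hC, Matrix.one_mulVec]
  have hsemi : ∀ X, f (B.mulVec X) = B.mulVec (F X) := by
    intro X
    rw [hf', hACB, hF, Matrix.mulVec_sub]
  have hinj : Function.Injective f → Function.Injective F := by
    intro h X Y hXY
    have hB : B.mulVec X = B.mulVec Y := h (by rw [hsemi, hsemi, hXY])
    have hA : A.mulVec X = A.mulVec Y := by rw [← hACB X, hB, hACB]
    rw [hF, hF, hA] at hXY
    exact sub_left_injective hXY
  have hpre : ∀ x Y, f x = B.mulVec Y →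
      F (Y + cube3 (A.mulVec (C.mulVec x))) = Y := by
    intro x Y hx
    have hB : B.mulVec (Y + cube3 (A.mulVec (C.mulVec x))) = x := by
      rw [Matrix.mulVec_add, ← hx, hf', sub_add_cancel]
    rw [hF, ← hACB (Y + _), hB, add_sub_cancel_right]
  have hsurj : Function.Surjective f → Function.Surjective F := by
    intro h Y
    obtain ⟨x, hx⟩ := h (B.mulVec Y)
    exact ⟨_, hpre x Y hx⟩
  refine ⟨hinj, hsurj, fun h => ⟨⟨hinj h.1, hsurj h.2⟩, fun Y => ?_⟩⟩
  have hinv : Function.invFun F Y =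
      Y + cube3 (A.mulVec (C.mulVec (Function.invFun f (B.mulVec Y)))) :=
    hinj h.1 ((Function.invFun_eq (hsurj h.2 Y)).trans
      (hpre _ Y (Function.invFun_eq (h.2 (B.mulVec Y)))).symm)
  refine ⟨hinv, ?_⟩
  rw [hinv, hF]
  abel
end
end

section
/- Let 𝕏 be a complex Banach space, γ : 𝕏 × 𝕏 × 𝕏 → 𝕏 a continuous symmetric trilinear map, φ(x) := x − γ(x,x,x), and λ ∈ ℂ with λ ≠ 0 and |λ| ≠ 1. Define homogeneous maps Ψ_m : 𝕏 → 𝕏 recursively by Ψ₀ := 0, Ψ₁ := id, and Ψ_m := (1−λ^{m−1})⁻¹ · Σ_{p+q+r=m, 0≤p,q,r<m} γ(Ψ_p, Ψ_q, Ψ_r) for m ≥ 2. Then there exists r > 0 such that the series κ_λ(y) := Σ_{m≥0} Ψ_m(y) converges for ‖y‖ < r, defining an analytic function κ_λ on the ball of radius r with κ_λ(0) = 0, κ_λ′(0) = id, and λ·φ(κ_λ(y)) = κ_λ(λ·y) whenever y and λ·y both lie in the ball. -/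
noncomputable section

section

set_option maxSynthPendingDepth 3

/-- Diagonal values of multilinear maps are stable under products given by a bilinear map, with
the expected norm bound. -/
theorem ContinuousLinearMap.exists_multilinear_bilin_diag
    {V E F G : Type*} [NormedAddCommGroup V] [NormedSpace ℂ V]
    [NormedAddCommGroup E] [NormedSpace ℂ E] [NormedAddCommGroup F] [NormedSpace ℂ F]
    [NormedAddCommGroup G] [NormedSpace ℂ G] (f : E →L[ℂ] F →L[ℂ] G) {p q : ℕ}
    (P : V [×p]→L[ℂ] E) (Q : V [×q]→L[ℂ] F) :
    ∃ M : V [×(p + q)]→L[ℂ] G, ‖M‖ ≤ ‖f‖ * ‖P‖ * ‖Q‖ ∧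
      ∀ y, M (fun _ => y) = f (P fun _ => y) (Q fun _ => y) := by
  let T : (F →L[ℂ] G) →L[ℂ] (V [×q]→L[ℂ] G) :=
    (ContinuousLinearMap.compContinuousMultilinearMapL ℂ (fun _ : Fin q => V) F G).flip Q
  let M₁ : V [×p]→L[ℂ] (V [×q]→L[ℂ] G) :=
    T.compContinuousMultilinearMap (f.compContinuousMultilinearMap P)
  refine ⟨M₁.uncurrySum.domDomCongr finSumFinEquiv, ?_, fun y => rfl⟩
  refine ContinuousMultilinearMap.opNorm_le_bound (by positivity) fun v => ?_
  have h : (M₁.uncurrySum.domDomCongr finSumFinEquiv) v =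
      f (P fun i => v (Fin.castAdd q i)) (Q fun i => v (Fin.natAdd p i)) := rfl
  rw [h, Fin.prod_univ_add]
  calc _ ≤ ‖f‖ * ‖P fun i => v (Fin.castAdd q i)‖ * ‖Q fun i => v (Fin.natAdd p i)‖ :=
        f.le_opNorm₂ _ _
    _ ≤ ‖f‖ * (‖P‖ * ∏ i, ‖v (Fin.castAdd q i)‖) * (‖Q‖ * ∏ i, ‖v (Fin.natAdd p i)‖) := by
        gcongr
        · exact P.le_opNorm _
        · exact Q.le_opNorm _
    _ = _ := by ring

/-- Diagonal values of multilinear maps are stable under products given by a trilinear map, with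
the expected norm bound. -/
theorem ContinuousLinearMap.exists_multilinear_trilin_diag
    {V : Type*} [NormedAddCommGroup V] [NormedSpace ℂ V]
    (f : V →L[ℂ] V →L[ℂ] V →L[ℂ] V) {p q r m : ℕ} (hm : p + q + r = m)
    (P : V [×p]→L[ℂ] V) (Q : V [×q]→L[ℂ] V) (R : V [×r]→L[ℂ] V) :
    ∃ M : V [×m]→L[ℂ] V, ‖M‖ ≤ ‖f‖ * (‖P‖ * ‖Q‖ * ‖R‖) ∧
      ∀ y, M (fun _ => y) = f (P fun _ => y) (Q fun _ => y) (R fun _ => y) := by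
  subst hm
  obtain ⟨N, hN, hNd⟩ := f.exists_multilinear_bilin_diag P Q
  obtain ⟨M, hM, hMd⟩ :=
    (ContinuousLinearMap.id ℂ (V →L[ℂ] V)).exists_multilinear_bilin_diag N R
  refine ⟨M, ?_, fun y => by rw [hMd, hNd]; rfl⟩
  calc ‖M‖ ≤ ‖ContinuousLinearMap.id ℂ (V →L[ℂ] V)‖ * ‖N‖ * ‖R‖ := hM
    _ ≤ 1 * (‖f‖ * ‖P‖ * ‖Q‖) * ‖R‖ := by
        gcongr
        exact ContinuousLinearMap.norm_id_le
    _ = _ := by ring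

/-- The scalar sequence of coefficients of the power series solution of `S = t + K * S ^ 3`. -/
def cubicMajorant (K : ℝ) : ℕ → ℝ
  | 0 => 0
  | 1 => 1
  | m + 2 => K * ∑ p : Fin (m + 2), ∑ q : Fin (m + 2), ∑ r : Fin (m + 2),
      if (p : ℕ) + q + r = m + 2 then
        cubicMajorant K p * cubicMajorant K q * cubicMajorant K r else 0
  decreasing_by all_goals exact Fin.is_lt _

theorem cubicMajorant_rec (K : ℝ) {m : ℕ} (hm : 2 ≤ m) :
    cubicMajorant K m = K * ∑ p ∈ Finset.range m, ∑ q ∈ Finset.range m, ∑ r ∈ Finset.range m,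
      if p + q + r = m then
        cubicMajorant K p * cubicMajorant K q * cubicMajorant K r else 0 := by
  obtain ⟨m, rfl⟩ := Nat.exists_eq_add_of_le' hm
  rw [cubicMajorant]
  simp only [Finset.sum_range]

theorem cubicMajorant_nonneg {K : ℝ} (hK : 0 ≤ K) (m : ℕ) : 0 ≤ cubicMajorant K m := by
  induction m using Nat.strong_induction_on with
  | _ m ih =>
    rcases lt_or_ge m 2 with h | h
    · interval_cases m <;> simp [cubicMajorant]
    · rw [cubicMajorant_rec K h]
      refine mul_nonneg hK (Finset.sum_nonneg fun p hp => Finset.sum_nonneg fun q hq =>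
        Finset.sum_nonneg fun r hr => ?_)
      have := ih p (Finset.mem_range.1 hp)
      have := ih q (Finset.mem_range.1 hq)
      have := ih r (Finset.mem_range.1 hr)
      split_ifs <;> positivity

theorem sum_cubicMajorant_mul_pow_le {K t : ℝ} (hK : 0 ≤ K) (ht : 0 ≤ t)
    (hKt : 8 * K * t ^ 2 ≤ 1) (n : ℕ) :
    ∑ m ∈ Finset.range n, cubicMajorant K m * t ^ m ≤ 2 * t := by
  have ha (m : ℕ) : 0 ≤ cubicMajorant K m * t ^ m :=
    mul_nonneg (cubicMajorant_nonneg hK m) (pow_nonneg ht m)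
  set a : ℕ → ℝ := fun m => cubicMajorant K m * t ^ m with ha_def
  induction n with
  | zero => simpa using ht
  | succ n ih =>
    have h3 (p q r : ℕ) : 0 ≤ a p * a q * a r := mul_nonneg (mul_nonneg (ha p) (ha q)) (ha r)
    have hite (m p q r : ℕ) : 0 ≤ if p + q + r = m then a p * a q * a r else 0 := by
      split_ifs
      exacts [h3 p q r, le_rfl]
    have key : ∀ m ∈ Finset.range (n + 1), a m ≤ (if m = 1 then t else 0) +
        K * ∑ x ∈ Finset.range n ×ˢ Finset.range n ×ˢ Finset.range n,
          if x.1 + x.2.1 + x.2.2 = m then a x.1 * a x.2.1 * a x.2.2 else 0 := by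
      intro m hm
      have hnn (s : Finset (ℕ × ℕ × ℕ)) : 0 ≤ K * ∑ x ∈ s,
          if x.1 + x.2.1 + x.2.2 = m then a x.1 * a x.2.1 * a x.2.2 else 0 :=
        mul_nonneg hK (Finset.sum_nonneg fun x _ => hite _ _ _ _)
      rcases lt_or_ge m 2 with h | h
      · have := hnn (Finset.range n ×ˢ Finset.range n ×ˢ Finset.range n)
        interval_cases m
        · simpa [ha_def, cubicMajorant] using this
        · simpa [ha_def, cubicMajorant] using this
      · have hmn : m ≤ n := Nat.lt_succ_iff.1 (Finset.mem_range.1 hm)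
        have hsub : Finset.range m ⊆ Finset.range n := Finset.range_mono hmn
        have heq : a m = K * ∑ x ∈ Finset.range m ×ˢ Finset.range m ×ˢ Finset.range m,
            if x.1 + x.2.1 + x.2.2 = m then a x.1 * a x.2.1 * a x.2.2 else 0 := by
          simp only [ha_def, cubicMajorant_rec K h, Finset.sum_product, mul_assoc,
            Finset.sum_mul]
          congr 1
          refine Finset.sum_congr rfl fun p _ => Finset.sum_congr rfl fun q _ =>
            Finset.sum_congr rfl fun r _ => ?_
          split_ifs with hs
          · rw [← hs]; ring
          · simp
        rw [if_neg (by lia), zero_add, heq]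
        refine mul_le_mul_of_nonneg_left ?_ hK
        exact Finset.sum_le_sum_of_subset_of_nonneg
          (Finset.product_subset_product hsub (Finset.product_subset_product hsub hsub))
          fun x _ _ => hite _ _ _ _
    have hS : 0 ≤ ∑ m ∈ Finset.range n, a m := Finset.sum_nonneg fun m _ => ha m
    calc ∑ m ∈ Finset.range (n + 1), a m
        ≤ ∑ m ∈ Finset.range (n + 1), ((if m = 1 then t else 0) +
          K * ∑ x ∈ Finset.range n ×ˢ Finset.range n ×ˢ Finset.range n,
            if x.1 + x.2.1 + x.2.2 = m then a x.1 * a x.2.1 * a x.2.2 else 0) :=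
          Finset.sum_le_sum key
      _ ≤ t + K * ∑ x ∈ Finset.range n ×ˢ Finset.range n ×ˢ Finset.range n,
            a x.1 * a x.2.1 * a x.2.2 := by
          rw [Finset.sum_add_distrib, ← Finset.mul_sum, Finset.sum_comm]
          gcongr with x
          · rw [Finset.sum_ite_eq']
            split_ifs
            exacts [le_rfl, ht]
          · rw [Finset.sum_ite_eq]
            split_ifs
            exacts [le_rfl, h3 _ _ _]
      _ = t + K * (∑ m ∈ Finset.range n, a m) ^ 3 := by
          simp only [Finset.sum_product, ← Finset.mul_sum, ← Finset.sum_mul]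
          ring
      _ ≤ t + K * (2 * t) ^ 3 := by gcongr
      _ = t + 8 * K * t ^ 2 * t := by ring
      _ ≤ t + 1 * t := by gcongr
      _ = 2 * t := by ring

/-- Cauchy product of three absolutely convergent series under a continuous trilinear map. -/
theorem ContinuousLinearMap.hasSum_trilin_cauchyProduct
    {V : Type*} [NormedAddCommGroup V] [NormedSpace ℂ V] [CompleteSpace V]
    (f : V →L[ℂ] V →L[ℂ] V →L[ℂ] V) {u : ℕ → V} (hu : Summable fun m => ‖u m‖)
    (hu0 : u 0 = 0) :
    HasSum (fun m => ∑ p ∈ Finset.range m, ∑ q ∈ Finset.range m, ∑ r ∈ Finset.range m,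
        if p + q + r = m then f (u p) (u q) (u r) else 0)
      (f (∑' m, u m) (∑' m, u m) (∑' m, u m)) := by
  have hs : HasSum u (∑' m, u m) := hu.of_norm.hasSum
  set k := ∑' m, u m
  let g : (ℕ × ℕ) × ℕ → V := fun x => f (u x.1.1) (u x.1.2) (u x.2)
  have hg : Summable g := by
    have h2 := hu.mul_of_nonneg hu (fun _ => norm_nonneg _) (fun _ => norm_nonneg _)
    have h3 := h2.mul_of_nonneg hu (fun _ => by positivity) (fun _ => norm_nonneg _)
    refine Summable.of_norm_bounded (h3.mul_left ‖f‖) fun x => ?_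
    calc ‖g x‖ ≤ ‖f (u x.1.1) (u x.1.2)‖ * ‖u x.2‖ := ContinuousLinearMap.le_opNorm _ _
      _ ≤ ‖f‖ * ‖u x.1.1‖ * ‖u x.1.2‖ * ‖u x.2‖ := by
          gcongr
          exact f.le_opNorm₂ _ _
      _ = _ := by ring
  obtain ⟨a, hga⟩ := hg
  have h1 : HasSum (fun x : ℕ × ℕ => f (u x.1) (u x.2) k) a :=
    hga.prod_fiberwise fun x => (f (u x.1) (u x.2)).hasSum hs
  have h2 : HasSum (fun p => f (u p) k k) a :=
    h1.prod_fiberwise fun p => ((f (u p)).flip k).hasSum hs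
  have hak : a = f k k k := h2.unique (((f.flip k).flip k).hasSum hs)
  rw [← hak]
  let w : (ℕ × ℕ) × ℕ → ℕ := fun x => x.1.1 + x.1.2 + x.2
  convert hga.tsum_fiberwise w using 2 with m
  have hind (x : (ℕ × ℕ) × ℕ) :
      (w ⁻¹' {m}).indicator g x = if x.1.1 + x.1.2 + x.2 = m then g x else 0 := by
    split_ifs with h
    · exact Set.indicator_of_mem (s := w ⁻¹' {m}) h g
    · exact Set.indicator_of_notMem (s := w ⁻¹' {m}) h g
  rw [tsum_subtype (w ⁻¹' {m}) g,
    tsum_eq_sum (s := (Finset.range m ×ˢ Finset.range m) ×ˢ Finset.range m)]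
  · simp only [hind, Finset.sum_product, g]
  · rintro ⟨⟨p, q⟩, r⟩ hx
    simp only [Finset.mem_product, Finset.mem_range] at hx
    simp only [hind, g]
    split_ifs with h
    · have : p = 0 ∨ q = 0 ∨ r = 0 := by lia
      rcases this with rfl | rfl | rfl <;> simp [hu0]
    · rfl

theorem norm_inv_one_sub_pow_le {z : ℂ} (hz : ‖z‖ ≠ 1) {n : ℕ} (hn : 1 ≤ n) :
    ‖(1 - z ^ n)⁻¹‖ ≤ |1 - ‖z‖|⁻¹ := by
  have hpos : 0 < |1 - ‖z‖| := abs_pos.2 (sub_ne_zero.2 hz.symm)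
  rw [norm_inv]
  refine inv_anti₀ hpos ?_
  have h1 : |1 - ‖z‖ ^ n| ≤ ‖1 - z ^ n‖ := by
    simpa using abs_norm_sub_norm_le (1 : ℂ) (z ^ n)
  refine le_trans ?_ h1
  have h0 := norm_nonneg z
  rcases lt_or_gt_of_ne hz with h | h
  · have := pow_le_of_le_one h0 h.le (by lia : n ≠ 0)
    rw [abs_of_pos (by linarith), abs_of_nonneg (by linarith)]
    linarith
  · have := le_self_pow₀ h.le (by lia : n ≠ 0)
    rw [abs_of_neg (by linarith), abs_of_nonpos (by linarith)]
    linarith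

/-- Terms given by a cubic recursion with bounded coefficients are the diagonal values of
multilinear maps whose norms are controlled by the scalar majorant. -/
theorem exists_multilinear_of_cubic_rec
    {V : Type*} [NormedAddCommGroup V] [NormedSpace ℂ V]
    (f : V →L[ℂ] V →L[ℂ] V →L[ℂ] V) (c : ℕ → ℂ) {C : ℝ} (hc : ∀ m, 2 ≤ m → ‖c m‖ ≤ C)
    (Ψ : ℕ → V → V) (hΨ0 : Ψ 0 = 0) (hΨ1 : Ψ 1 = id)
    (hΨrec : ∀ m, 2 ≤ m → ∀ y : V, Ψ m y = c m •
      ∑ p ∈ Finset.range m, ∑ q ∈ Finset.range m, ∑ r ∈ Finset.range m,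
        if p + q + r = m then f (Ψ p y) (Ψ q y) (Ψ r y) else 0) (m : ℕ) :
    ∃ P : V [×m]→L[ℂ] V, ‖P‖ ≤ cubicMajorant (C * ‖f‖) m ∧ ∀ y, P (fun _ => y) = Ψ m y := by
  have hC : 0 ≤ C := (norm_nonneg _).trans (hc 2 le_rfl)
  have hK : 0 ≤ C * ‖f‖ := mul_nonneg hC (norm_nonneg f)
  induction m using Nat.strong_induction_on with
  | _ m ih =>
    rcases lt_or_ge m 2 with h | h
    · interval_cases m
      · exact ⟨0, by simp [cubicMajorant], by simp [hΨ0]⟩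
      · refine ⟨(continuousMultilinearCurryFin1 ℂ V V).symm (ContinuousLinearMap.id ℂ V), ?_,
          fun y => by simp [hΨ1]⟩
        rw [LinearIsometryEquiv.norm_map]
        simpa [cubicMajorant] using ContinuousLinearMap.norm_id_le (𝕜 := ℂ) (E := V)
    · choose! P hP hPd using ih
      have hterm (p q r : ℕ) (hp : p ∈ Finset.range m) (hq : q ∈ Finset.range m)
          (hr : r ∈ Finset.range m) : ∃ M : V [×m]→L[ℂ] V,
          ‖M‖ ≤ (if p + q + r = m then ‖f‖ * (cubicMajorant (C * ‖f‖) p *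
            cubicMajorant (C * ‖f‖) q * cubicMajorant (C * ‖f‖) r) else 0) ∧
          ∀ y, M (fun _ => y) = if p + q + r = m then f (Ψ p y) (Ψ q y) (Ψ r y) else 0 := by
        rw [Finset.mem_range] at hp hq hr
        by_cases hs : p + q + r = m
        · obtain ⟨M, hM, hMd⟩ := f.exists_multilinear_trilin_diag hs (P p) (P q) (P r)
          refine ⟨M, ?_, fun y => by rw [hMd, if_pos hs, hPd p hp, hPd q hq, hPd r hr]⟩
          rw [if_pos hs]
          refine hM.trans ?_
          have := cubicMajorant_nonneg hK p
          have := cubicMajorant_nonneg hK q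
          gcongr
          exacts [hP p hp, hP q hq, hP r hr]
        · exact ⟨0, by simp [hs], by simp [hs]⟩
      choose! M hM hMd using hterm
      refine ⟨c m • ∑ p ∈ Finset.range m, ∑ q ∈ Finset.range m, ∑ r ∈ Finset.range m, M p q r,
        ?_, fun y => ?_⟩
      · rw [norm_smul, cubicMajorant_rec _ h, mul_assoc]
        gcongr
        · exact hc m h
        · simp only [Finset.mul_sum, mul_ite, mul_zero]
          refine norm_sum_le_of_le _ fun p hp => norm_sum_le_of_le _ fun q hq =>
            norm_sum_le_of_le _ fun r hr => hM p q r hp hq hr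
      · rw [hΨrec m h y]
        simp only [smul_apply, sum_apply]
        congr 1
        exact Finset.sum_congr rfl fun p hp => Finset.sum_congr rfl fun q hq =>
          Finset.sum_congr rfl fun r hr => hMd p q r hp hq hr y

end

/-- Local existence of the pre-conjugation `κ_λ` for a cubic-homogeneous map
`φ(x) = x − γ(x,x,x)` on a complex Banach space: the Taylor terms `Ψ_m`,
defined by the recursion `Ψ₀ = 0`, `Ψ₁ = id`,
`Ψ_m = (1 − λ^{m−1})⁻¹ Σ_{p+q+r=m, p,q,r<m} γ(Ψ_p, Ψ_q, Ψ_r)`,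
sum to a function `κ_λ` that converges and is analytic on a ball of some
radius `r > 0`, with `κ_λ(0) = 0`, `κ_λ′(0) = id`, and
`λ·φ(κ_λ(y)) = κ_λ(λ·y)` whenever `y` and `λ·y` lie in the ball. -/
theorem preconjugation_local_existence
    {𝕏 : Type*} [NormedAddCommGroup 𝕏] [NormedSpace ℂ 𝕏] [CompleteSpace 𝕏]
    (γ : 𝕏 →L[ℂ] 𝕏 →L[ℂ] 𝕏 →L[ℂ] 𝕏)
    (hsymm : ∀ x y z, γ x y z = γ y x z ∧ γ x y z = γ x z y)
    (φ : 𝕏 → 𝕏) (hφ : ∀ x, φ x = x - γ x x x)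
    (lam : ℂ) (hlam0 : lam ≠ 0) (hlam1 : ‖lam‖ ≠ 1)
    (Ψ : ℕ → 𝕏 → 𝕏)
    (hΨ0 : Ψ 0 = 0) (hΨ1 : Ψ 1 = id)
    (hΨrec : ∀ m, 2 ≤ m → ∀ y : 𝕏, Ψ m y = (1 - lam ^ (m - 1))⁻¹ •
      ∑ p ∈ Finset.range m, ∑ q ∈ Finset.range m, ∑ r ∈ Finset.range m,
        if p + q + r = m then γ (Ψ p y) (Ψ q y) (Ψ r y) else 0) :
    ∃ r > (0 : ℝ),
      (∀ y : 𝕏, ‖y‖ < r → Summable fun m => Ψ m y) ∧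
      AnalyticOnNhd ℂ (fun y => ∑' m, Ψ m y) (Metric.ball 0 r) ∧
      (∑' m, Ψ m (0 : 𝕏)) = 0 ∧
      fderiv ℂ (fun y => ∑' m, Ψ m y) 0 = ContinuousLinearMap.id ℂ 𝕏 ∧
      ∀ y : 𝕏, ‖y‖ < r → ‖lam • y‖ < r →
        lam • φ (∑' m, Ψ m y) = ∑' m, Ψ m (lam • y) := by
  set_option maxSynthPendingDepth 3 in
  have hpos : 0 < |1 - ‖lam‖| := abs_pos.2 (sub_ne_zero.2 hlam1.symm)
  set K : ℝ := |1 - ‖lam‖|⁻¹ * ‖γ‖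
  have hK : 0 ≤ K := by positivity
  choose P hP hPd using exists_multilinear_of_cubic_rec γ (fun m => (1 - lam ^ (m - 1))⁻¹)
    (fun m hm => norm_inv_one_sub_pow_le hlam1 (by lia : 1 ≤ m - 1)) Ψ hΨ0 hΨ1 hΨrec
  obtain ⟨t, ht, hKt⟩ : ∃ t : ℝ, 0 < t ∧ 8 * K * t ^ 2 ≤ 1 := by
    refine ⟨(8 * K + 1)⁻¹, by positivity, ?_⟩
    rw [inv_pow, ← div_eq_mul_inv, div_le_one (by positivity)]
    nlinarith
  have hbound := sum_cubicMajorant_mul_pow_le hK ht.le hKt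
  have hb (m : ℕ) : 0 ≤ cubicMajorant K m * t ^ m :=
    mul_nonneg (cubicMajorant_nonneg hK m) (pow_nonneg ht.le m)
  have hsum : Summable fun m => cubicMajorant K m * t ^ m := summable_of_sum_range_le hb hbound
  have hnorm (y : 𝕏) (hy : ‖y‖ < t) : Summable fun m => ‖Ψ m y‖ := by
    refine Summable.of_nonneg_of_le (fun _ => norm_nonneg _) (fun m => ?_) hsum
    rw [← hPd m y]
    calc ‖P m fun _ => y‖ ≤ ‖P m‖ * ‖y‖ ^ m := by simpa using (P m).le_opNorm fun _ => y
      _ ≤ cubicMajorant K m * t ^ m := by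
          gcongr
          · exact cubicMajorant_nonneg hK m
          · exact hP m
  let S : FormalMultilinearSeries ℂ 𝕏 𝕏 := P
  have hκ : (fun y => ∑' m, Ψ m y) = S.sum :=
    funext fun y => tsum_congr fun m => (hPd m y).symm
  have hrad : ENNReal.ofReal t ≤ S.radius := by
    refine S.le_radius_of_bound (2 * t) (r := t.toNNReal) fun n => ?_
    rw [Real.coe_toNNReal t ht.le]
    calc ‖S n‖ * t ^ n ≤ cubicMajorant K n * t ^ n := by
          gcongr
          exact hP n
      _ ≤ ∑ m ∈ Finset.range (n + 1), cubicMajorant K m * t ^ m :=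
          Finset.single_le_sum (fun m _ => hb m) (Finset.self_mem_range_succ n)
      _ ≤ 2 * t := hbound _
  have hS : HasFPowerSeriesOnBall (fun y => ∑' m, Ψ m y) S 0 S.radius :=
    hκ ▸ S.hasFPowerSeriesOnBall ((ENNReal.ofReal_pos.2 ht).trans_le hrad)
  refine ⟨t, ht, fun y hy => (hnorm y hy).of_norm, ?_, ?_, ?_, fun y hy hly => ?_⟩
  · refine hS.analyticOnNhd.mono ?_
    rw [← Metric.eball_ofReal]
    exact Metric.eball_subset_eball hrad
  · have h0 (m : ℕ) : Ψ m (0 : 𝕏) = 0 := by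
      rcases Nat.eq_zero_or_pos m with rfl | hm
      · simp [hΨ0]
      · rw [← hPd m 0]
        exact (P m).map_coord_zero ⟨0, hm⟩ rfl
    simp [h0]
  · rw [hS.hasFPowerSeriesAt.fderiv_eq]
    ext y
    have h1 : S 1 (fun _ => y) = y := by simpa [hΨ1] using hPd 1 y
    rw [continuousMultilinearCurryFin1_apply, ContinuousLinearMap.id_apply, ← h1]
    congr 1
    ext i
    simp [Fin.snoc, h1]
  · have hN := γ.hasSum_trilin_cauchyProduct (hnorm y hy) (by simp [hΨ0])
    have hL := (((hnorm y hy).of_norm.hasSum).sub hN).const_smul lam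
    rw [hφ, ← hL.tsum_eq]
    refine tsum_congr fun m => ?_
    have hhom : Ψ m (lam • y) = lam ^ m • Ψ m y := by
      rw [← hPd m, ← hPd m]
      simpa using (P m).map_smul_univ (fun _ => lam) (fun _ => y)
    rw [hhom]
    rcases lt_or_ge m 2 with h | h
    · interval_cases m <;> simp [hΨ0]
    · have hne : 1 - lam ^ (m - 1) ≠ 0 := by
        intro h0
        have h1 : ‖lam‖ ^ (m - 1) = 1 := by
          rw [← norm_pow, ← sub_eq_zero.1 h0, norm_one]
        exact hlam1 ((pow_eq_one_iff_of_nonneg (norm_nonneg _) (by lia)).1 h1)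
      have hrec := (inv_smul_eq_iff₀ hne).1 (hΨrec m h y).symm
      have hpow : lam ^ m = lam * lam ^ (m - 1) := by
        rw [← pow_succ', Nat.sub_add_cancel (by lia)]
      rw [hrec, hpow, sub_smul, one_smul, sub_sub_cancel, smul_smul]
end
end

section
/- Let 𝕏 be a complex Banach space, γ : 𝕏 × 𝕏 × 𝕏 → 𝕏 a continuous symmetric trilinear map, φ(x) := x − γ(x,x,x), and λ ∈ ℂ with |λ| > 1. Then there exists an analytic function κ_λ : 𝕏 → 𝕏 defined on all of 𝕏 with κ_λ(0) = 0, κ_λ′(0) = id, and λ·φ(κ_λ(y)) = κ_λ(λ·y) for all y ∈ 𝕏. -/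
noncomputable section

open Filter Topology

/-- The Banach space of bounded sequences in `X`, with the supremum norm. -/
def BddSeq (X : Type*) [NormedAddCommGroup X] : Type _ := BoundedContinuousFunction ℕ X

namespace BddSeq

variable {X : Type*} [NormedAddCommGroup X]

instance : NormedAddCommGroup (BddSeq X) :=
  inferInstanceAs (NormedAddCommGroup (BoundedContinuousFunction ℕ X))

instance [NormedSpace ℂ X] : NormedSpace ℂ (BddSeq X) :=
  inferInstanceAs (NormedSpace ℂ (BoundedContinuousFunction ℕ X))

instance [CompleteSpace X] : CompleteSpace (BddSeq X) :=
  inferInstanceAs (CompleteSpace (BoundedContinuousFunction ℕ X))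

instance : CoeFun (BddSeq X) fun _ => ℕ → X :=
  ⟨fun v => (show BoundedContinuousFunction ℕ X from v)⟩

/-- The bounded sequence with given terms. -/
def mk (f : ℕ → X) (C : ℝ) (h : ∀ n, ‖f n‖ ≤ C) : BddSeq X :=
  BoundedContinuousFunction.ofNormedAddCommGroupDiscrete f C h

@[simp]
lemma mk_apply (f : ℕ → X) (C : ℝ) (h : ∀ n, ‖f n‖ ≤ C) (n : ℕ) : mk f C h n = f n := rfl

lemma norm_mk_le {f : ℕ → X} {C : ℝ} (hC : 0 ≤ C) (h : ∀ n, ‖f n‖ ≤ C) : ‖mk f C h‖ ≤ C :=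
  (BoundedContinuousFunction.norm_le hC).2 h

lemma norm_apply_le (v : BddSeq X) (n : ℕ) : ‖v n‖ ≤ ‖v‖ :=
  BoundedContinuousFunction.norm_coe_le_norm _ n

@[ext]
lemma ext {v w : BddSeq X} (h : ∀ n, v n = w n) : v = w :=
  BoundedContinuousFunction.ext h

@[simp]
lemma zero_apply (n : ℕ) : (0 : BddSeq X) n = 0 := rfl

@[simp]
lemma add_apply (v w : BddSeq X) (n : ℕ) : (v + w) n = v n + w n := rfl

@[simp]
lemma sub_apply (v w : BddSeq X) (n : ℕ) : (v - w) n = v n - w n := rfl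

@[simp]
lemma smul_apply [NormedSpace ℂ X] (c : ℂ) (v : BddSeq X) (n : ℕ) : (c • v) n = c • v n := rfl

variable (X) [NormedSpace ℂ X]

/-- Evaluation of a bounded sequence at an index. -/
def eval (n : ℕ) : BddSeq X →L[ℂ] X :=
  LinearMap.mkContinuous
    { toFun := fun v => v n
      map_add' := fun _ _ => rfl
      map_smul' := fun _ _ => rfl }
    1 (fun v => by rw [one_mul]; exact v.norm_apply_le n)

/-- Pointwise evaluation of a bounded sequence of operators on a bounded sequence of vectors, as a
continuous bilinear map. -/
def pointwiseApply (Y : Type*) [NormedAddCommGroup Y] [NormedSpace ℂ Y] :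
    BddSeq (X →L[ℂ] Y) →L[ℂ] BddSeq X →L[ℂ] BddSeq Y :=
  have bound (f : BddSeq (X →L[ℂ] Y)) (v : BddSeq X) (n : ℕ) : ‖f n (v n)‖ ≤ ‖f‖ * ‖v‖ :=
    (f n).le_of_opNorm_le_of_le (f.norm_apply_le n) (v.norm_apply_le n)
  LinearMap.mkContinuous₂
    (LinearMap.mk₂ ℂ (fun f v => mk (fun n => f n (v n)) (‖f‖ * ‖v‖) (bound f v))
      (fun f g v => by ext n; simp)
      (fun c f v => by ext n; simp)
      (fun f v w => by ext n; simp)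
      (fun c f v => by ext n; simp))
    1 (fun f v => by
      rw [one_mul]
      exact norm_mk_le (by positivity) (bound f v))

/-- The embedding of a space into bounded sequences as constant sequences. -/
def const : X →L[ℂ] BddSeq X :=
  LinearMap.mkContinuous
    { toFun := fun x => mk (fun _ => x) ‖x‖ fun _ => le_rfl
      map_add' := fun _ _ => rfl
      map_smul' := fun _ _ => rfl }
    1 (fun x => by rw [one_mul]; exact norm_mk_le (norm_nonneg x) fun _ => le_rfl)

/-- The left shift on bounded sequences. -/
def shift : BddSeq X →L[ℂ] BddSeq X :=
  LinearMap.mkContinuous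
    { toFun := fun v => mk (fun n => v (n + 1)) ‖v‖ fun _ => v.norm_apply_le _
      map_add' := fun _ _ => rfl
      map_smul' := fun _ _ => rfl }
    1 (fun v => by
      rw [one_mul]
      exact norm_mk_le (norm_nonneg v) fun _ => v.norm_apply_le _)

/-- Multiplication of a bounded sequence by the powers of a number `μ` with `‖μ‖ ≤ 1`. -/
def powMul (μ : ℂ) (hμ : ‖μ‖ ≤ 1) : BddSeq X →L[ℂ] BddSeq X :=
  pointwiseApply X X
    (mk (fun n => μ ^ n • ContinuousLinearMap.id ℂ X) 1 fun n => by
      rw [norm_smul, norm_pow]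
      exact mul_le_one₀ (pow_le_one₀ (norm_nonneg _) hμ) (norm_nonneg _)
        ContinuousLinearMap.norm_id_le)

/-- A continuous linear map applied to each term of a bounded sequence. -/
def mapCLM {Y : Type*} [NormedAddCommGroup Y] [NormedSpace ℂ Y] (g : X →L[ℂ] Y) :
    BddSeq X →L[ℂ] BddSeq Y :=
  pointwiseApply X Y (mk (fun _ => g) ‖g‖ fun _ => le_rfl)

variable {X}

@[simp]
lemma eval_apply (n : ℕ) (v : BddSeq X) : eval X n v = v n := rfl

@[simp]
lemma pointwiseApply_apply {Y : Type*} [NormedAddCommGroup Y] [NormedSpace ℂ Y]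
    (f : BddSeq (X →L[ℂ] Y)) (v : BddSeq X) (n : ℕ) : pointwiseApply X Y f v n = f n (v n) := rfl

@[simp]
lemma const_apply (x : X) (n : ℕ) : const X x n = x := rfl

@[simp]
lemma shift_apply (v : BddSeq X) (n : ℕ) : shift X v n = v (n + 1) := rfl

@[simp]
lemma powMul_apply (μ : ℂ) (hμ : ‖μ‖ ≤ 1) (v : BddSeq X) (n : ℕ) :
    powMul X μ hμ v n = μ ^ n • v n := rfl

lemma norm_smul_shift_lt_one (X : Type*) [NormedAddCommGroup X] [NormedSpace ℂ X]
    {μ : ℂ} (hμ : ‖μ‖ < 1) : ‖μ • shift X‖ < 1 := by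
  rw [norm_smul]
  refine lt_of_le_of_lt (mul_le_of_le_one_right (norm_nonneg _) ?_) hμ
  exact LinearMap.mkContinuous_norm_le _ zero_le_one _

attribute [irreducible] instNormedAddCommGroup instNormedSpaceComplex

lemma _root_.ContDiff.pointwiseApply {E X Y : Type*} [NormedAddCommGroup E] [NormedSpace ℂ E]
    [NormedAddCommGroup X] [NormedSpace ℂ X] [NormedAddCommGroup Y] [NormedSpace ℂ Y]
    {c : E → BddSeq (X →L[ℂ] Y)} {u : E → BddSeq X} {k : WithTop ℕ∞}
    (hc : ContDiff ℂ k c) (hu : ContDiff ℂ k u) :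
    ContDiff ℂ k (fun p => BddSeq.pointwiseApply X Y (c p) (u p)) := by
  have h := (BddSeq.pointwiseApply X Y).contDiff (n := k)
  exact (h.comp hc).clm_apply hu

/-- The product rule for pointwise application, at a common zero of both factors. -/
lemma hasFDerivAt_pointwiseApply_of_eq_zero {E X Y : Type*} [NormedAddCommGroup E]
    [NormedSpace ℂ E] [NormedAddCommGroup X] [NormedSpace ℂ X] [NormedAddCommGroup Y]
    [NormedSpace ℂ Y] {c : E → BddSeq (X →L[ℂ] Y)} {u : E → BddSeq X} {p : E}
    (hc : DifferentiableAt ℂ c p) (hu : DifferentiableAt ℂ u p) (hc0 : c p = 0) (hu0 : u p = 0) :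
    HasFDerivAt (fun q => pointwiseApply X Y (c q) (u q)) (0 : E →L[ℂ] BddSeq Y) p := by
  have h := (((pointwiseApply X Y).hasFDerivAt).comp p hc.hasFDerivAt).clm_apply
    hu.hasFDerivAt
  refine h.congr_fderiv ?_
  ext v
  simp [hc0, hu0]

variable (γ : X →L[ℂ] X →L[ℂ] X →L[ℂ] X)

/-- The cubic map `z ↦ γ(z, z, z)`, applied pointwise to bounded sequences. -/
def pointwiseCube (z : BddSeq X) : BddSeq X :=
  pointwiseApply X X (pointwiseApply X (X →L[ℂ] X)
    (mapCLM X (Y := X →L[ℂ] X →L[ℂ] X) γ z) z) z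

@[simp]
lemma pointwiseCube_apply (z : BddSeq X) (n : ℕ) :
    pointwiseCube γ z n = γ (z n) (z n) (z n) := rfl

@[simp]
lemma pointwiseCube_zero : pointwiseCube γ 0 = 0 := by
  ext n
  simp

lemma contDiff_pointwiseApply_mapCLM {k : WithTop ℕ∞} :
    ContDiff ℂ k fun z => pointwiseApply X (X →L[ℂ] X) (mapCLM X (Y := X →L[ℂ] X →L[ℂ] X) γ z) z := by
  have h := (mapCLM X (Y := X →L[ℂ] X →L[ℂ] X) γ).contDiff (n := k)
  exact h.pointwiseApply contDiff_id

lemma contDiff_pointwiseCube {k : WithTop ℕ∞} : ContDiff ℂ k (pointwiseCube γ) :=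
  (contDiff_pointwiseApply_mapCLM γ).pointwiseApply contDiff_id

lemma hasFDerivAt_pointwiseCube_zero :
    HasFDerivAt (pointwiseCube γ) (0 : BddSeq X →L[ℂ] BddSeq X) 0 := by
  have h := (contDiff_pointwiseApply_mapCLM γ (k := 1)).differentiable one_ne_zero 0
  exact hasFDerivAt_pointwiseApply_of_eq_zero h differentiableAt_id (map_zero _) rfl

end BddSeq

/-- `1 - T` is an invertible operator when `‖T‖ < 1`. -/
def oneSubEquivOfNormLtOne {E : Type*} [NormedAddCommGroup E] [NormedSpace ℂ E] [CompleteSpace E]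
    (T : E →L[ℂ] E) (hT : ‖T‖ < 1) : E ≃L[ℂ] E :=
  ContinuousLinearEquiv.unitsEquiv ℂ E (Units.oneSub T hT)

@[simp]
lemma oneSubEquivOfNormLtOne_apply {E : Type*} [NormedAddCommGroup E] [NormedSpace ℂ E]
    [CompleteSpace E] (T : E →L[ℂ] E) (hT : ‖T‖ < 1) (v : E) :
    oneSubEquivOfNormLtOne T hT v = v - T v := rfl

open BddSeq

section LocalPreconjugation

variable {X : Type*} [NormedAddCommGroup X] [NormedSpace ℂ X]

/-- For `v` the rescaled sequence `y + μ ^ (n + 1) • w (n + 1)`. -/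
def preconjugationOrbit (μ : ℂ) (hμ : ‖μ‖ ≤ 1) : X × BddSeq X →L[ℂ] BddSeq X :=
  (const X).comp (.fst ℂ X _) +
    μ • (powMul X μ hμ).comp ((shift X).comp (.snd ℂ X _))

lemma preconjugationOrbit_apply (μ : ℂ) (hμ : ‖μ‖ ≤ 1) (p : X × BddSeq X) (n : ℕ) :
    preconjugationOrbit μ hμ p n = p.1 + μ ^ (n + 1) • p.2 (n + 1) := by
  simp [preconjugationOrbit, pow_succ', mul_smul]

variable (γ : X →L[ℂ] X →L[ℂ] X →L[ℂ] X)

/-- The operator whose zeros, in the second component, describe backward orbits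
`x n = μ ^ n • (y + μ ^ n • w n)` of `x ↦ μ⁻¹ • (x - γ x x x)`. -/
def backwardOrbitMap (μ : ℂ) (hμ : ‖μ‖ ≤ 1) (p : X × BddSeq X) : X × BddSeq X :=
  (p.1, (p.2 - μ • shift X p.2) + μ ^ 2 • powMul X μ hμ
    (pointwiseCube γ (preconjugationOrbit μ hμ p)))

lemma backwardOrbitMap_snd_apply (μ : ℂ) (hμ : ‖μ‖ ≤ 1) (p : X × BddSeq X) (n : ℕ) :
    (backwardOrbitMap γ μ hμ p).2 n = (p.2 n - μ • p.2 (n + 1)) + μ ^ (n + 2) •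
      γ (p.1 + μ ^ (n + 1) • p.2 (n + 1)) (p.1 + μ ^ (n + 1) • p.2 (n + 1))
        (p.1 + μ ^ (n + 1) • p.2 (n + 1)) := by
  simp only [backwardOrbitMap, BddSeq.add_apply, BddSeq.sub_apply, BddSeq.smul_apply,
    shift_apply, powMul_apply, pointwiseCube_apply, preconjugationOrbit_apply]
  module

lemma backwardOrbitMap_zero (μ : ℂ) (hμ : ‖μ‖ ≤ 1) : backwardOrbitMap γ μ hμ 0 = 0 := by
  simp [backwardOrbitMap]

lemma contDiff_backwardOrbitMap (μ : ℂ) (hμ : ‖μ‖ ≤ 1) {k : WithTop ℕ∞} :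
    ContDiff ℂ k (backwardOrbitMap γ μ hμ) := by
  have h : ContDiff ℂ k fun p => pointwiseCube γ (preconjugationOrbit μ hμ p) := by
    have hL := (preconjugationOrbit (X := X) μ hμ).contDiff (n := k)
    exact (contDiff_pointwiseCube γ).comp hL
  unfold backwardOrbitMap
  fun_prop

lemma hasFDerivAt_backwardOrbitMap [CompleteSpace X] (μ : ℂ) (hμ : ‖μ‖ < 1) :
    HasFDerivAt (backwardOrbitMap γ μ hμ.le)
      (((ContinuousLinearEquiv.refl ℂ X).prodCongr
        (oneSubEquivOfNormLtOne _ (norm_smul_shift_lt_one X hμ)) :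
        (X × BddSeq X) ≃L[ℂ] (X × BddSeq X)) : X × BddSeq X →L[ℂ] X × BddSeq X) 0 := by
  have hN : HasFDerivAt (fun p => pointwiseCube γ (preconjugationOrbit μ hμ.le p))
      ((0 : BddSeq X →L[ℂ] BddSeq X).comp (preconjugationOrbit μ hμ.le)) 0 := by
    have hL := (preconjugationOrbit (X := X) μ hμ.le).hasFDerivAt (x := 0)
    refine HasFDerivAt.comp (g := pointwiseCube γ) 0 ?_ hL
    rw [map_zero]
    exact hasFDerivAt_pointwiseCube_zero γ
  have hN' := ((powMul X μ hμ.le).hasFDerivAt.comp _ hN).const_smul (μ ^ 2)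
  have hL := (((oneSubEquivOfNormLtOne _ (norm_smul_shift_lt_one X hμ) :
    BddSeq X →L[ℂ] BddSeq X).comp
      (ContinuousLinearMap.snd ℂ X (BddSeq X))).hasFDerivAt (x := 0)).add hN'
  have hG := ((ContinuousLinearMap.fst ℂ X (BddSeq X)).hasFDerivAt (x := 0)).prodMk hL
  refine hG.congr_fderiv ?_
  ext <;> simp

/-- Shifting a backward orbit gives a backward orbit. -/
lemma backwardOrbitMap_shift (μ : ℂ) (hμ : ‖μ‖ ≤ 1) {y : X} {w : BddSeq X}
    (h : backwardOrbitMap γ μ hμ (y, w) = (y, 0)) :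
    backwardOrbitMap γ μ hμ (μ • y, μ ^ 2 • shift X w) = (μ • y, 0) := by
  refine Prod.ext rfl ?_
  ext n
  have hn := backwardOrbitMap_snd_apply γ μ hμ (y, w) (n + 1)
  rw [h] at hn
  have hv : μ • y + μ ^ (n + 1) • μ ^ 2 • w (n + 2) = μ • (y + μ ^ (n + 2) • w (n + 2)) := by
    module
  rw [backwardOrbitMap_snd_apply]
  simp only [BddSeq.smul_apply, shift_apply]
  rw [hv]
  have hn' := congrArg (fun v => μ ^ 2 • v) hn
  simp only [BddSeq.zero_apply, smul_zero] at hn' ⊢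
  rw [hn']
  simp only [map_smul, _root_.smul_apply]
  module

/-- Local existence of the pre-conjugation. -/
lemma exists_local_preconjugation [CompleteSpace X] (μ : ℂ) (hμ : ‖μ‖ < 1) :
    ∃ κ : X → X, AnalyticAt ℂ κ 0 ∧ κ 0 = 0 ∧
      HasFDerivAt κ (ContinuousLinearMap.id ℂ X) 0 ∧
      ∀ᶠ y in 𝓝 0, κ (μ • y) - γ (κ (μ • y)) (κ (μ • y)) (κ (μ • y)) = μ • κ y := by
  set G := backwardOrbitMap γ μ hμ.le with hGdef
  have hG0 : G 0 = 0 := backwardOrbitMap_zero γ μ hμ.le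
  have hG : ContDiffAt ℂ (⊤ : WithTop ℕ∞) G 0 :=
    (contDiff_backwardOrbitMap γ μ hμ.le).contDiffAt
  have hG' := hasFDerivAt_backwardOrbitMap γ μ hμ
  have hs := hG.hasStrictFDerivAt' hG' (by simp)
  set H : X × BddSeq X → X × BddSeq X := hs.localInverse G _ 0
  have hHan : AnalyticAt ℂ H 0 := by
    have := hG.to_localInverse hG' (by simp)
    rw [hG0] at this
    exact this.analyticAt
  have hH0 : H 0 = 0 := by
    have := hs.localInverse_apply_image
    rwa [hG0] at this
  have hH' := hs.to_localInverse.hasFDerivAt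
  rw [hG0] at hH'
  let ι : X →L[ℂ] X × BddSeq X := .inl ℂ X (BddSeq X)
  let ev : X × BddSeq X →L[ℂ] X := .fst ℂ X _ + (eval X 0).comp (.snd ℂ X _)
  have hι0 : ι 0 = 0 := map_zero ι
  have hHι : AnalyticAt ℂ (fun y => H (ι y)) 0 :=
    AnalyticAt.comp (by rwa [hι0]) (ι.analyticAt 0)
  refine ⟨fun y => ev (H (ι y)), (ev.analyticAt _).comp hHι, ?_, ?_, ?_⟩
  · simp [hι0, hH0]
  · have h1 := HasFDerivAt.comp (g := H) (f := ι) 0 (by rwa [hι0]) ι.hasFDerivAt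
    have hev := ev.hasFDerivAt (x := H (ι 0))
    have h2 := HasFDerivAt.comp (g := ev) (f := fun y => H (ι y)) 0 hev h1
    refine h2.congr_fderiv ?_
    ext x
    simp [ι, ev]
  · have hright : ∀ᶠ y in 𝓝 (0 : X), G (H (ι y)) = ι y := by
      have h := hs.eventually_right_inverse
      rw [hG0] at h
      exact (ι.continuous.tendsto' 0 0 hι0).eventually h
    have hcont : ContinuousAt
        (fun y : X => (μ • y, μ ^ 2 • shift X (H (ι y)).2)) 0 := by
      have hc := hHι.continuousAt
      have hS := (shift X).continuous
      exact (continuousAt_id.const_smul μ).prodMk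
        ((hS.continuousAt.comp hc.snd).const_smul (μ ^ 2))
    have hleft : ∀ᶠ y in 𝓝 (0 : X), H (G (μ • y, μ ^ 2 • shift X (H (ι y)).2)) =
        (μ • y, μ ^ 2 • shift X (H (ι y)).2) := by
      have h0 : (μ • (0 : X), μ ^ 2 • shift X (H (ι 0)).2) = 0 := by simp [hι0, hH0]
      have hl := hs.eventually_left_inverse
      have ht := hcont.tendsto
      rw [h0] at ht
      exact ht.eventually hl
    filter_upwards [hright, hleft] with y hy1 hy2
    obtain ⟨⟨z, w⟩, hzw⟩ : ∃ p, H (ι y) = p := ⟨_, rfl⟩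
    have hz : z = y := by
      rw [hzw] at hy1
      exact congrArg Prod.fst hy1
    subst hz
    rw [hzw] at hy1 hy2
    rw [hGdef, backwardOrbitMap_shift γ μ hμ.le hy1] at hy2
    have hκ : ev (H (ι (μ • z))) = μ • (z + μ • w 1) := by
      rw [show ι (μ • z) = (μ • z, 0) from rfl, hy2]
      simp [ev, pow_two, mul_smul]
    have hn := backwardOrbitMap_snd_apply γ μ hμ.le (z, w) 0
    rw [← hGdef, hy1] at hn
    have hn' := congrArg (fun v => μ • v) hn
    simp only [ι, ContinuousLinearMap.inl_apply, BddSeq.zero_apply, smul_zero, zero_add,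
      pow_one] at hn'
    rw [hκ]
    simp only [ev, hzw, map_smul, _root_.smul_apply]
    simp only [_root_.add_apply, ContinuousLinearMap.comp_apply,
      ContinuousLinearMap.coe_fst', ContinuousLinearMap.coe_snd', eval_apply]
    rw [← sub_eq_zero, ← neg_eq_zero, hn']
    module

end LocalPreconjugation

/-- A local analytic solution of `F ∘ κ = κ ∘ (lam • ·)` with `‖lam‖ > 1` and `F` entire extends to
a global one. -/
lemma exists_global_of_local_semiconj {X : Type*} [NormedAddCommGroup X] [NormedSpace ℂ X]
    [CompleteSpace X] {F : X → X} (hF : AnalyticOnNhd ℂ F Set.univ) {lam : ℂ} (hlam : 1 < ‖lam‖)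
    {κ₀ : X → X} (han : AnalyticAt ℂ κ₀ 0)
    (hκ₀ : ∀ᶠ y in 𝓝 0, F (κ₀ (lam⁻¹ • y)) = κ₀ y) :
    ∃ κ : X → X, AnalyticOnNhd ℂ κ Set.univ ∧ κ =ᶠ[𝓝 0] κ₀ ∧ ∀ y, F (κ y) = κ (lam • y) := by
  have hlam0 : lam ≠ 0 := by rintro rfl; simp at hlam; linarith
  obtain ⟨r, hr, hball⟩ := Metric.eventually_nhds_iff.1 (han.eventually_analyticAt.and hκ₀)
  simp only [dist_zero_right] at hball
  have hinv : ‖lam⁻¹‖ < 1 := by rw [norm_inv]; exact inv_lt_one_of_one_lt₀ hlam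
  let A : ℕ → X → X := fun n y => F^[n] (κ₀ (lam⁻¹ ^ n • y))
  have hnorm (n : ℕ) (y : X) (h : ‖lam⁻¹ ^ n • y‖ < r) : ‖lam⁻¹ ^ (n + 1) • y‖ < r := by
    rw [pow_succ', mul_smul, norm_smul]
    exact (mul_le_of_le_one_left (norm_nonneg _) hinv.le).trans_lt h
  have hstep (n : ℕ) (y : X) (h : ‖lam⁻¹ ^ n • y‖ < r) : A (n + 1) y = A n y := by
    simp only [A, Function.iterate_succ_apply]
    rw [pow_succ', mul_smul, (hball h).2]
  have hstable (n m : ℕ) (hnm : n ≤ m) (y : X) (h : ‖lam⁻¹ ^ n • y‖ < r) :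
      ‖lam⁻¹ ^ m • y‖ < r ∧ A m y = A n y := by
    induction m, hnm using Nat.le_induction with
    | base => exact ⟨h, rfl⟩
    | succ m _ ih => exact ⟨hnorm m y ih.1, (hstep m y ih.1).trans ih.2⟩
  have hex (y : X) : ∃ n : ℕ, ‖lam⁻¹ ^ n • y‖ < r := by
    have ht : Tendsto (fun n : ℕ => ‖lam⁻¹ ^ n • y‖) atTop (𝓝 0) := by
      have := ((tendsto_pow_atTop_nhds_zero_of_norm_lt_one hinv).smul_const y).norm
      simpa using this
    exact (ht.eventually_lt_const hr).exists
  choose N hN using hex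
  have hκ (n : ℕ) (y : X) (h : ‖lam⁻¹ ^ n • y‖ < r) : A (N y) y = A n y := by
    rcases le_total n (N y) with h' | h'
    · exact (hstable _ _ h' y h).2
    · exact (hstable _ _ h' y (hN y)).2.symm
  have hopen (n : ℕ) (y : X) (h : ‖lam⁻¹ ^ n • y‖ < r) : (fun y => A (N y) y) =ᶠ[𝓝 y] A n := by
    have : ∀ᶠ z in 𝓝 y, ‖lam⁻¹ ^ n • z‖ < r :=
      (by fun_prop : Continuous fun z : X => ‖lam⁻¹ ^ n • z‖).continuousAt.eventually_lt_const h
    exact this.mono fun z hz => hκ n z hz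
  have hiter (n : ℕ) : AnalyticOnNhd ℂ F^[n] Set.univ := by
    induction n with
    | zero => exact analyticOnNhd_id
    | succ n ih => exact ih.comp hF (Set.mapsTo_univ _ _)
  refine ⟨fun y => A (N y) y, fun y _ => ?_, ?_, fun y => ?_⟩
  · refine AnalyticAt.congr ?_ (hopen _ y (hN y)).symm
    refine (hiter _ _ (Set.mem_univ _)).comp ?_
    exact AnalyticAt.comp (hball (hN y)).1
      ((lam⁻¹ ^ N y • ContinuousLinearMap.id ℂ X).analyticAt y)
  · simpa [A] using! hopen 0 0 (by simpa using hr)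
  · have h1 : lam⁻¹ ^ (N y + 1) • lam • y = lam⁻¹ ^ N y • y := by
      rw [pow_succ, mul_smul, inv_smul_smul₀ hlam0]
    change F (A (N y) y) = A (N (lam • y)) (lam • y)
    rw [hκ (N y + 1) (lam • y) (by rw [h1]; exact hN y)]
    simp only [A]
    rw [h1, Function.iterate_succ_apply']

/-- Global existence of the pre-conjugation `κ_λ` for a cubic-homogeneous map
`φ(x) = x − γ(x,x,x)` on a complex Banach space when `|λ| > 1`:
there is an analytic `κ_λ : 𝕏 → 𝕏` with `κ_λ(0) = 0`, `κ_λ′(0) = id` and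
`λ·φ(κ_λ(y)) = κ_λ(λ·y)` for all `y`. -/
theorem preconjugation_global_existence_of_big_lambda
    {𝕏 : Type*} [NormedAddCommGroup 𝕏] [NormedSpace ℂ 𝕏] [CompleteSpace 𝕏]
    (γ : 𝕏 →L[ℂ] 𝕏 →L[ℂ] 𝕏 →L[ℂ] 𝕏)
    (hsymm : ∀ x y z, γ x y z = γ y x z ∧ γ x y z = γ x z y)
    (φ : 𝕏 → 𝕏) (hφ : ∀ x, φ x = x - γ x x x)
    (lam : ℂ) (hlam : 1 < ‖lam‖) :
    ∃ κ : 𝕏 → 𝕏,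
      AnalyticOnNhd ℂ κ Set.univ ∧
      κ 0 = 0 ∧
      fderiv ℂ κ 0 = ContinuousLinearMap.id ℂ 𝕏 ∧
      ∀ y : 𝕏, lam • φ (κ y) = κ (lam • y) := by
  have hlam0 : lam ≠ 0 := norm_pos_iff.1 (zero_lt_one.trans hlam)
  have hinv : ‖lam⁻¹‖ < 1 := by rw [norm_inv]; exact inv_lt_one_of_one_lt₀ hlam
  obtain ⟨κ₀, han, h0, hd, hloc⟩ := exists_local_preconjugation γ lam⁻¹ hinv
  have hF : AnalyticOnNhd ℂ (fun x => lam • φ x) Set.univ := by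
    have hc : ContDiff ℂ (⊤ : WithTop ℕ∞) (fun x => lam • φ x) := by
      simp only [hφ]
      fun_prop
    exact fun x _ => hc.contDiffAt.analyticAt
  obtain ⟨κ, hκ, heq, hsemi⟩ := exists_global_of_local_semiconj hF hlam han <| by
    filter_upwards [hloc] with y hy
    rw [hφ, hy, smul_inv_smul₀ hlam0]
  exact ⟨κ, hκ, heq.eq_of_nhds.trans h0, heq.fderiv_eq.trans hd.fderiv, hsemi⟩
end
end

section
/- Let γ : ℂ^n × ℂ^n × ℂ^n → ℂ^n be a symmetric trilinear map, φ(x) := x − γ(x,x,x), and λ ∈ ℂ with λ ≠ 0 and |λ| ≠ 1. Let U be a connected open neighbourhood of 0 in ℂ^n and κ_λ : U → ℂ^n analytic with κ_λ(0) = 0, κ_λ′(0) = I_n, and λ·φ(κ_λ(y)) = κ_λ(λ·y) whenever y, λ·y ∈ U. If the Jacobian determinant det φ′(x) is constant on ℂ^n, then det κ_λ′(y) = 1 for all y ∈ U. -/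
noncomputable section

theorem differentiable_trilinear_diagonal {n : ℕ} {F : Type*} [NormedAddCommGroup F]
    [NormedSpace ℂ F]
    (γ : (Fin n → ℂ) →ₗ[ℂ] (Fin n → ℂ) →ₗ[ℂ] (Fin n → ℂ) →ₗ[ℂ] F) :
    Differentiable ℂ fun x => γ x x x := by
  have key : (fun x => γ x x x) = fun x : Fin n → ℂ =>
      ∑ i, x i • ∑ j, x j • ∑ k, x k • γ (Pi.single i 1) (Pi.single j 1) (Pi.single k 1) := by
    funext x
    rw [LinearMap.pi_apply_eq_sum_univ γ x]
    simp only [LinearMap.sum_apply, LinearMap.smul_apply]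
    refine Finset.sum_congr rfl fun i _ => ?_
    rw [LinearMap.pi_apply_eq_sum_univ (γ fun j => if i = j then 1 else 0) x]
    simp only [LinearMap.sum_apply, LinearMap.smul_apply]
    congr 1
    refine Finset.sum_congr rfl fun j _ => ?_
    rw [LinearMap.pi_apply_eq_sum_univ ((γ fun j => if i = j then 1 else 0) _) x]
    have single_eq (i : Fin n) : (fun j => if i = j then (1 : ℂ) else 0) = Pi.single i 1 := by
      funext j
      simp [Pi.single_apply, eq_comm]
    simp only [single_eq]
  rw [key]
  fun_prop

theorem analyticAt_det_fderiv {n : ℕ} {κ : (Fin n → ℂ) → (Fin n → ℂ)} {y : Fin n → ℂ}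
    (h : AnalyticAt ℂ κ y) :
    AnalyticAt ℂ (fun y => LinearMap.det (fderiv ℂ κ y).toLinearMap) y := by
  have hentry (i j : Fin n) : AnalyticAt ℂ (fun y => fderiv ℂ κ y (Pi.single j 1) i) y := by
    let L : ((Fin n → ℂ) →L[ℂ] (Fin n → ℂ)) →L[ℂ] ℂ :=
      (ContinuousLinearMap.proj (R := ℂ) (φ := fun _ : Fin n => ℂ) i).comp
        (ContinuousLinearMap.apply ℂ (Fin n → ℂ) (Pi.single j 1))
    exact (L.analyticAt _).comp h.fderiv
  simp only [← LinearMap.det_toMatrix', Matrix.det_apply', LinearMap.toMatrix'_apply]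
  refine Finset.analyticAt_fun_sum _ fun σ _ => analyticAt_const.mul ?_
  refine Finset.analyticAt_fun_prod _ fun i _ => ?_
  simpa [Pi.single_apply] using hentry (σ i) i

/-- A function continuous at `0` which is invariant under a strict contraction on a ball
around `0` is constant on that ball. -/
theorem eq_apply_zero_of_smul_invariant {E X : Type*} [NormedAddCommGroup E] [NormedSpace ℂ E]
    [TopologicalSpace X] [T2Space X] {J : E → X} {r : ℝ} {lam : ℂ} (hlam : ‖lam‖ < 1)
    (hcont : ContinuousAt J 0) (hinv : ∀ y ∈ Metric.ball (0 : E) r, J (lam • y) = J y)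
    {y : E} (hy : y ∈ Metric.ball (0 : E) r) : J y = J 0 := by
  have hiter (k : ℕ) : lam ^ k • y ∈ Metric.ball (0 : E) r ∧ J (lam ^ k • y) = J y := by
    induction k with
    | zero => simpa using hy
    | succ k ih =>
      rw [pow_succ', mul_smul, hinv _ ih.1]
      refine ⟨?_, ih.2⟩
      have h := ih.1
      rw [mem_ball_zero_iff] at h ⊢
      rw [norm_smul]
      exact (mul_le_of_le_one_left (norm_nonneg _) hlam.le).trans_lt h
  have hlim : Filter.Tendsto (fun k : ℕ => lam ^ k • y) Filter.atTop (nhds 0) := by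
    simpa using (tendsto_pow_atTop_nhds_zero_of_norm_lt_one hlam).smul_const y
  have hJ := hcont.tendsto.comp hlim
  refine tendsto_nhds_unique (tendsto_const_nhds.congr fun k => ?_) hJ
  exact (hiter k).2.symm

/-- If `φ(x) = x − γ(x,x,x)` has constant Jacobian determinant on `ℂ^n`, then
any normalized pre-conjugation `κ_λ` of `φ`, analytic on a connected open
neighbourhood `U` of `0`, has Jacobian determinant identically `1` on `U`. -/
theorem preconjugation_jacobian_one_of_constant_jacobian (n : ℕ)
    (γ : (Fin n → ℂ) →ₗ[ℂ] (Fin n → ℂ) →ₗ[ℂ] (Fin n → ℂ) →ₗ[ℂ] (Fin n → ℂ))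
    (hsymm : ∀ x y z, γ x y z = γ y x z ∧ γ x y z = γ x z y)
    (φ : (Fin n → ℂ) → (Fin n → ℂ)) (hφ : ∀ x, φ x = x - γ x x x)
    (lam : ℂ) (hlam0 : lam ≠ 0) (hlam1 : ‖lam‖ ≠ 1)
    (U : Set (Fin n → ℂ)) (hUopen : IsOpen U) (hUconn : IsConnected U)
    (hU0 : (0 : Fin n → ℂ) ∈ U)
    (κ : (Fin n → ℂ) → (Fin n → ℂ))
    (hκan : AnalyticOnNhd ℂ κ U)
    (hκ0 : κ 0 = 0)
    (hκ'0 : fderiv ℂ κ 0 = ContinuousLinearMap.id ℂ (Fin n → ℂ))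
    (hconj : ∀ y : Fin n → ℂ, y ∈ U → lam • y ∈ U →
      lam • φ (κ y) = κ (lam • y))
    (hdet : ∃ c : ℂ, ∀ x : Fin n → ℂ,
      LinearMap.det (fderiv ℂ φ x).toLinearMap = c) :
    ∀ y ∈ U, LinearMap.det (fderiv ℂ κ y).toLinearMap = 1 := by
  obtain ⟨c, hc⟩ := hdet
  have hφd : Differentiable ℂ φ := by
    rw [funext hφ]
    exact differentiable_id.sub (differentiable_trilinear_diagonal γ)
  set J : (Fin n → ℂ) → ℂ := fun y => LinearMap.det (fderiv ℂ κ y).toLinearMap with hJ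
  have hJan : AnalyticOnNhd ℂ J U := fun y hy => analyticAt_det_fderiv (hκan y hy)
  have hJ0 : J 0 = 1 := by simp [hJ, hκ'0]
  have hscale {y : Fin n → ℂ} (hy : y ∈ U) (hly : lam • y ∈ U) : c * J y = J (lam • y) := by
    have hleft : HasFDerivAt (fun y => lam • φ (κ y))
        (lam • (fderiv ℂ φ (κ y)).comp (fderiv ℂ κ y)) y :=
      ((hφd (κ y)).hasFDerivAt.comp y (hκan y hy).differentiableAt.hasFDerivAt).const_smul lam
    have hright : HasFDerivAt (fun y => κ (lam • y))
        ((fderiv ℂ κ (lam • y)).comp (lam • ContinuousLinearMap.id ℂ (Fin n → ℂ))) y :=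
      HasFDerivAt.comp y (hκan _ hly).differentiableAt.hasFDerivAt
        ((hasFDerivAt_id y).const_smul lam)
    have hev : (fun y => lam • φ (κ y)) =ᶠ[nhds y] fun y => κ (lam • y) := by
      filter_upwards [hUopen.mem_nhds hy,
        (continuous_const_smul lam).continuousAt.preimage_mem_nhds (hUopen.mem_nhds hly)]
        with z hz hlz using hconj z hz hlz
    have hderiv := hleft.unique (hright.congr_of_eventuallyEq hev)
    have hcomp : (fderiv ℂ φ (κ y)).toLinearMap ∘ₗ (fderiv ℂ κ y).toLinearMap
        = (fderiv ℂ κ (lam • y)).toLinearMap := by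
      refine LinearMap.ext fun w => smul_right_injective _ hlam0 ?_
      simpa using DFunLike.congr_fun hderiv _
    simp only [hJ]
    rw [← hc (κ y), ← LinearMap.det_comp, hcomp]
  have hc1 : c = 1 := by
    have h := hscale hU0 (by simpa using hU0)
    simpa [hJ0] using h
  subst hc1
  obtain ⟨r, hr, hrU⟩ := Metric.isOpen_iff.1 hUopen 0 hU0
  have hcont : ContinuousAt J 0 := (hJan 0 hU0).continuousAt
  have hmem {a : ℂ} (ha : ‖a‖ < 1) {y : Fin n → ℂ} (hy : y ∈ Metric.ball 0 r) : a • y ∈ U := by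
    apply hrU
    rw [mem_ball_zero_iff] at hy ⊢
    rw [norm_smul]
    exact (mul_le_of_le_one_left (norm_nonneg _) ha.le).trans_lt hy
  have hball : ∀ y ∈ Metric.ball (0 : Fin n → ℂ) r, J y = 1 := by
    intro y hy
    rw [← hJ0]
    rcases lt_or_gt_of_ne hlam1 with hlt | hgt
    · refine eq_apply_zero_of_smul_invariant hlt hcont (fun z hz => ?_) hy
      rw [← hscale (hrU hz) (hmem hlt hz), one_mul]
    · have hinv : ‖lam⁻¹‖ < 1 := by
        rw [norm_inv]
        exact inv_lt_one_of_one_lt₀ hgt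
      refine eq_apply_zero_of_smul_invariant hinv hcont (fun z hz => ?_) hy
      have h := hscale (hmem hinv hz) (by rw [smul_inv_smul₀ hlam0]; exact hrU hz)
      rwa [smul_inv_smul₀ hlam0, one_mul] at h
  exact hJan.eqOn_of_preconnected_of_eventuallyEq analyticOnNhd_const hUconn.isPreconnected hU0
    (Filter.eventually_of_mem (Metric.ball_mem_nhds 0 hr) hball)
end
end

section
/- Let 𝕏 be a complex Banach space, γ : 𝕏 × 𝕏 × 𝕏 → 𝕏 a continuous symmetric trilinear map, φ(x) := x − γ(x,x,x), and λ ∈ ℂ with λ ≠ 0, |λ| ≠ 1. With Ψ_m defined by Ψ₀ := 0, Ψ₁ := id, Ψ_m := (1−λ^{m−1})⁻¹ Σ_{p+q+r=m, 0≤p,q,r<m} γ(Ψ_p,Ψ_q,Ψ_r), and Φ_m defined by the same recursion with λ = 0, one has Ψ₇(x) = ((1−λ²)(1−λ⁴)(1−λ⁶))⁻¹ · ( Φ₇(x) + 3λ²·γ(γ(x,x,x), γ(x,x,x), x) ) for all x ∈ 𝕏. -/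
noncomputable section

set_option maxHeartbeats 800000 in
/-- The degree-7 term of the cubic recursion with parameter `μ`, expanded in terms of `γ`. -/
theorem cubic_recursion_degree_seven
    {𝕏 : Type*} [NormedAddCommGroup 𝕏] [NormedSpace ℂ 𝕏]
    (γ : 𝕏 →L[ℂ] 𝕏 →L[ℂ] 𝕏 →L[ℂ] 𝕏)
    (hsymm : ∀ x y z, γ x y z = γ y x z ∧ γ x y z = γ x z y)
    (μ : ℂ) (Ψ : ℕ → 𝕏 → 𝕏) (hΨ0 : Ψ 0 = 0) (hΨ1 : Ψ 1 = id)
    (hΨrec : ∀ m, 2 ≤ m → ∀ y : 𝕏, Ψ m y = (1 - μ ^ (m - 1))⁻¹ •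
      ∑ p ∈ Finset.range m, ∑ q ∈ Finset.range m, ∑ r ∈ Finset.range m,
        if p + q + r = m then γ (Ψ p y) (Ψ q y) (Ψ r y) else 0) (x : 𝕏) :
    Ψ 7 x = (1 - μ ^ 6)⁻¹ •
      ((9 * (1 - μ ^ 2)⁻¹ * (1 - μ ^ 4)⁻¹) • γ (γ (γ x x x) x x) x x +
        (3 * (1 - μ ^ 2)⁻¹ ^ 2) • γ (γ x x x) (γ x x x) x) := by
  have h0 : Ψ 0 x = 0 := by simp [hΨ0]
  have h1 : Ψ 1 x = x := by simp [hΨ1]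
  have hleft (u : 𝕏) : γ x u x = γ u x x := (hsymm x u x).1
  have hright (u : 𝕏) : γ x x u = γ u x x := by
    rw [(hsymm x x u).2, (hsymm x u x).1]
  have hmid (u : 𝕏) : γ u x u = γ u u x := (hsymm u x u).2
  have houter (u : 𝕏) : γ x u u = γ u u x := by
    rw [(hsymm x u u).1, (hsymm u x u).2]
  have h2 : Ψ 2 x = 0 := by
    rw [hΨrec 2 (by norm_num)]
    simp [Finset.sum_range_succ, h0]
  have h3 : Ψ 3 x = (1 - μ ^ 2)⁻¹ • γ x x x := by
    rw [hΨrec 3 (by norm_num)]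
    simp [Finset.sum_range_succ, h0, h1, h2]
  have h4 : Ψ 4 x = 0 := by
    rw [hΨrec 4 (by norm_num)]
    simp [Finset.sum_range_succ, h0, h2]
  have h5 : Ψ 5 x = (3 * (1 - μ ^ 2)⁻¹ * (1 - μ ^ 4)⁻¹) • γ (γ x x x) x x := by
    rw [hΨrec 5 (by norm_num)]
    simp only [Finset.sum_range_succ, Finset.sum_range_zero, h0, h1, h2, h3, h4]
    simp [hleft (γ x x x), hright (γ x x x)]
    module
  have h6 : Ψ 6 x = 0 := by
    rw [hΨrec 6 (by norm_num)]
    simp [Finset.sum_range_succ, h0, h2, h4]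
  rw [hΨrec 7 (by norm_num)]
  simp only [Finset.sum_range_succ, Finset.sum_range_zero, h0, h1, h2, h3, h4, h5, h6]
  generalize (1 - μ ^ 2)⁻¹ = a
  generalize (1 - μ ^ 4)⁻¹ = b
  simp [hleft (γ (γ x x x) x x), hright (γ (γ x x x) x x), hmid (γ x x x), houter (γ x x x)]
  module

/-- The degree-7 Taylor term of the pre-conjugation `κ_λ` of
`φ(x) = x − γ(x,x,x)` satisfies
`Ψ₇(x) = ((1−λ²)(1−λ⁴)(1−λ⁶))⁻¹ (Φ₇(x) + 3λ² γ(γ(x,x,x), γ(x,x,x), x))`,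
where `Φ₇` is the degree-7 term of the local inverse of `φ`. -/
theorem preconjugation_degree_seven_term
    {𝕏 : Type*} [NormedAddCommGroup 𝕏] [NormedSpace ℂ 𝕏] [CompleteSpace 𝕏]
    (γ : 𝕏 →L[ℂ] 𝕏 →L[ℂ] 𝕏 →L[ℂ] 𝕏)
    (hsymm : ∀ x y z, γ x y z = γ y x z ∧ γ x y z = γ x z y)
    (φ : 𝕏 → 𝕏) (hφ : ∀ x, φ x = x - γ x x x)
    (lam : ℂ) (hlam0 : lam ≠ 0) (hlam1 : ‖lam‖ ≠ 1)
    (Ψ : ℕ → 𝕏 → 𝕏) (Φ : ℕ → 𝕏 → 𝕏)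
    (hΨ0 : Ψ 0 = 0) (hΨ1 : Ψ 1 = id)
    (hΨrec : ∀ m, 2 ≤ m → ∀ y : 𝕏, Ψ m y = (1 - lam ^ (m - 1))⁻¹ •
      ∑ p ∈ Finset.range m, ∑ q ∈ Finset.range m, ∑ r ∈ Finset.range m,
        if p + q + r = m then γ (Ψ p y) (Ψ q y) (Ψ r y) else 0)
    (hΦ0 : Φ 0 = 0) (hΦ1 : Φ 1 = id)
    (hΦrec : ∀ m, 2 ≤ m → ∀ y : 𝕏, Φ m y = (1 - (0 : ℂ) ^ (m - 1))⁻¹ •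
      ∑ p ∈ Finset.range m, ∑ q ∈ Finset.range m, ∑ r ∈ Finset.range m,
        if p + q + r = m then γ (Φ p y) (Φ q y) (Φ r y) else 0) :
    ∀ x : 𝕏, Ψ 7 x = ((1 - lam ^ 2) * (1 - lam ^ 4) * (1 - lam ^ 6))⁻¹ •
      (Φ 7 x + (3 * lam ^ 2) • γ (γ x x x) (γ x x x) x) := by
  intro x
  have hpow (n : ℕ) (hn : n ≠ 0) : 1 - lam ^ n ≠ 0 := by
    intro h
    have h' : lam ^ n = 1 := (sub_eq_zero.mp h).symm
    apply hlam1
    rw [← pow_eq_one_iff_of_nonneg (norm_nonneg lam) hn, ← norm_pow, h', norm_one]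
  have h2 := hpow 2 (by norm_num)
  have h4 := hpow 4 (by norm_num)
  have h6 := hpow 6 (by norm_num)
  rw [cubic_recursion_degree_seven γ hsymm lam Ψ hΨ0 hΨ1 hΨrec x,
    cubic_recursion_degree_seven γ hsymm 0 Φ hΦ0 hΦ1 hΦrec x]
  match_scalars
  · field_simp
    ring
  · field_simp
    ring
end
end

section
/- Let A be an N×N complex matrix, F(X) := X − (A·X)^{*3}, and λ ∈ ℂ with λ ≠ 0, |λ| ≠ 1. Let K_λ : ℂ^N → ℂ^N be an analytic function with K_λ(0) = 0, K_λ′(0) = I_N, and λ·F(K_λ(X)) = K_λ(λ·X) for all X ∈ ℂ^N. Then for every X ∈ ℂ^N and every X₀ ∈ ker A one has K_λ(X + X₀) = K_λ(X) + X₀. -/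
open Matrix

noncomputable section

open Filter Topology Asymptotics in
/-- Two entire curves with the same 1-jet at `0`, both semiconjugating multiplication by `lam` to
`lam • F` with `F` tangent to the identity at `0`, coincide. -/
theorem eq_of_semiconj_of_deriv_eq {E : Type*} [NormedAddCommGroup E] [NormedSpace ℂ E]
    {F : E → E} (hF : HasStrictFDerivAt F (ContinuousLinearMap.id ℂ E) 0)
    {lam : ℂ} (hlam0 : lam ≠ 0) (hlam1 : ‖lam‖ ≠ 1) {p q : ℂ → E}
    (hp : AnalyticOnNhd ℂ p Set.univ) (hq : AnalyticOnNhd ℂ q Set.univ)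
    (hp0 : p 0 = 0) (hq0 : q 0 = 0) {v : E} (hp' : HasDerivAt p v 0) (hq' : HasDerivAt q v 0)
    (hpc : ∀ z, p (lam * z) = lam • F (p z)) (hqc : ∀ z, q (lam * z) = lam • F (q z)) :
    p = q := by
  have hd : AnalyticAt ℂ (p - q) 0 := (hp 0 trivial).sub (hq 0 trivial)
  by_cases hz : ∀ᶠ z in 𝓝 (0 : ℂ), (p - q) z = 0
  · exact hp.eq_of_eventuallyEq hq (hz.mono fun z h => sub_eq_zero.mp h)
  exfalso
  obtain ⟨k, g, hg, hg0, hdg⟩ := hd.exists_eventuallyEq_pow_smul_nonzero_iff.mpr hz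
  simp only [sub_zero, Pi.sub_apply] at hdg
  have hk : 2 ≤ k := by
    by_contra! hk
    interval_cases k
    · exact hg0 (by simpa [hp0, hq0] using hdg.self_of_nhds.symm)
    · have h1 : HasDerivAt (fun z => p z - q z) 0 0 := by
        simpa using hp'.fun_sub hq'
      have h2 : HasDerivAt (fun z : ℂ => z ^ 1 • g z) (g 0) 0 := by
        simpa using (hasDerivAt_id' (0 : ℂ)).fun_smul hg.differentiableAt.hasDerivAt
      exact hg0 ((h2.congr_of_eventuallyEq hdg).unique h1)
  have hpq : Tendsto (fun z => (p z, q z)) (𝓝 0) (𝓝 ((0 : E), (0 : E))) := by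
    simpa [hp0, hq0] using
      ((hp 0 trivial).continuousAt.prodMk (hq 0 trivial).continuousAt).tendsto
  have hgb : g =O[𝓝 0] (fun _ => (1 : ℂ)) := hg.continuousAt.isBigO_one ℂ
  have hdO : (fun z => p z - q z) =O[𝓝 0] (fun z : ℂ => z ^ k) := by
    refine IsBigO.congr' ((isBigO_refl (fun z : ℂ => z ^ k) _).smul hgb)
      (hdg.mono fun z h => h.symm) (.of_forall fun z => by simp)
  have hFo := ((hF.isLittleO.comp_tendsto hpq).trans_isBigO hdO).const_smul_left lam
  have hmul : Tendsto (fun z : ℂ => lam * z) (𝓝 0) (𝓝 0) := by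
    simpa using (continuous_const_mul lam).tendsto 0
  have hmain : (fun z : ℂ => z ^ k • (lam ^ k • g (lam * z) - lam • g z))
      =o[𝓝 0] (fun z : ℂ => z ^ k) := by
    refine hFo.congr' ?_ .rfl
    filter_upwards [hdg, hmul.eventually hdg] with z h1 h2
    rw [hpc, hqc, ← smul_sub, mul_pow, mul_comm, mul_smul] at h2
    simp only [Pi.smul_apply, Function.comp_apply, ContinuousLinearMap.id_apply]
    rw [smul_sub lam (F (p z) - F (q z)), h2, h1, smul_sub, smul_comm lam]
  have hlim : Tendsto (fun z : ℂ => lam ^ k • g (lam * z) - lam • g z) (𝓝[≠] 0) (𝓝 0) := by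
    rw [← isLittleO_one_iff ℂ]
    have h := hmain.mono (nhdsWithin_le_nhds (s := {0}ᶜ))
    have hinv := (isBigO_refl (fun z : ℂ => (z ^ k)⁻¹) (𝓝[≠] 0)).smul_isLittleO h
    refine hinv.congr' ?_ ?_ <;>
    · filter_upwards [self_mem_nhdsWithin] with z hz
      have : z ^ k ≠ 0 := pow_ne_zero k hz
      simp [this]
  have hlim' : Tendsto (fun z : ℂ => lam ^ k • g (lam * z) - lam • g z) (𝓝[≠] 0)
      (𝓝 (lam ^ k • g 0 - lam • g 0)) :=
    (((hg.continuousAt.tendsto.comp hmul).const_smul (lam ^ k)).sub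
      (hg.continuousAt.tendsto.const_smul lam)).mono_left nhdsWithin_le_nhds
  have heq := tendsto_nhds_unique hlim' hlim
  rw [← sub_smul, smul_eq_zero_iff_left hg0, sub_eq_zero] at heq
  obtain ⟨m, rfl⟩ := Nat.exists_eq_add_of_le' hk
  have h1 : lam ^ (m + 1) = 1 :=
    mul_right_cancel₀ hlam0 (by rw [← pow_succ, one_mul]; exact heq)
  exact hlam1 (Complex.norm_eq_one_of_pow_eq_one h1 m.succ_ne_zero)

theorem hasStrictFDerivAt_sub_cube3_mulVec {N : ℕ} (A : Matrix (Fin N) (Fin N) ℂ) :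
    HasStrictFDerivAt (fun X => X - cube3 (A.mulVec X))
      (ContinuousLinearMap.id ℂ (Fin N → ℂ)) 0 := by
  have hL (i : Fin N) : HasStrictFDerivAt (fun X : Fin N → ℂ => A.mulVec X i)
      ((ContinuousLinearMap.proj i).comp (LinearMap.toContinuousLinearMap A.mulVecLin)) 0 :=
    ((ContinuousLinearMap.proj (R := ℂ) (φ := fun _ : Fin N => ℂ) i).comp
      (LinearMap.toContinuousLinearMap A.mulVecLin)).hasStrictFDerivAt
  have hc : HasStrictFDerivAt (fun X => cube3 (A.mulVec X))
      (0 : (Fin N → ℂ) →L[ℂ] (Fin N → ℂ)) 0 := by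
    rw [hasStrictFDerivAt_pi']
    intro i
    refine ((hL i).pow 3).congr_fderiv ?_
    ext Y
    simp
  simpa using (hasStrictFDerivAt_id (𝕜 := ℂ) (0 : Fin N → ℂ)).sub hc

/-- A global pre-conjugation `K_λ` of a cubic-linear map `F(X) = X − (AX)^{*3}`
translates along the kernel of `A`: `K_λ(X + X₀) = K_λ(X) + X₀` for
`X₀ ∈ ker A`. -/
theorem preconjugation_translation_along_ker (N : ℕ)
    (A : Matrix (Fin N) (Fin N) ℂ)
    (F : (Fin N → ℂ) → (Fin N → ℂ))
    (hF : ∀ X, F X = X - cube3 (A.mulVec X))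
    (lam : ℂ) (hlam0 : lam ≠ 0) (hlam1 : ‖lam‖ ≠ 1)
    (K : (Fin N → ℂ) → (Fin N → ℂ))
    (hKan : AnalyticOnNhd ℂ K Set.univ)
    (hK0 : K 0 = 0)
    (hK'0 : fderiv ℂ K 0 = ContinuousLinearMap.id ℂ (Fin N → ℂ))
    (hconj : ∀ X : Fin N → ℂ, lam • F (K X) = K (lam • X)) :
    ∀ (X X₀ : Fin N → ℂ), X₀ ∈ LinearMap.ker A.mulVecLin →
      K (X + X₀) = K X + X₀ := by
  intro X X₀ hX₀
  have hA : A.mulVec X₀ = 0 := hX₀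
  obtain rfl : F = fun X => X - cube3 (A.mulVec X) := funext hF
  have hline (Y : Fin N → ℂ) :
      AnalyticOnNhd ℂ (fun z : ℂ => K (z • Y)) Set.univ := fun z _ =>
    (hKan (z • Y) trivial).comp (f := fun z : ℂ => z • Y) (analyticAt_id.smul analyticAt_const)
  have hline' (Y : Fin N → ℂ) : HasDerivAt (fun z : ℂ => K (z • Y)) Y 0 := by
    have h1 : HasFDerivAt K (ContinuousLinearMap.id ℂ (Fin N → ℂ)) ((0 : ℂ) • Y) := by
      rw [zero_smul, ← hK'0]
      exact (hKan 0 trivial).differentiableAt.hasFDerivAt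
    have h2 : HasDerivAt (fun z : ℂ => z • Y) Y 0 := by
      simpa using (hasDerivAt_id (0 : ℂ)).smul_const Y
    exact h1.comp_hasDerivAt 0 h2
  have h2 : HasDerivAt (fun z : ℂ => z • X₀) X₀ 0 := by
    simpa using (hasDerivAt_id (0 : ℂ)).smul_const X₀
  have key : (fun z : ℂ => K (z • (X + X₀)) - z • X₀) = fun z : ℂ => K (z • X) := by
    refine eq_of_semiconj_of_deriv_eq (hasStrictFDerivAt_sub_cube3_mulVec A) hlam0 hlam1
      ((hline _).sub fun z _ => analyticAt_id.smul analyticAt_const) (hline _)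
      (by simp [hK0]) (by simp [hK0]) (v := X) ?_ (hline' X) ?_ ?_
    · simpa using (hline' (X + X₀)).fun_sub h2
    · intro z
      simp only [mul_smul, ← hconj, mulVec_sub, mulVec_smul, hA, smul_zero, sub_zero, smul_sub]
      abel
    · intro z
      simp only [mul_smul, ← hconj]
  have h := congrFun key 1
  simp only [one_smul] at h
  exact sub_eq_iff_eq_add.mp h
end
end

section
/- Let A be a singular N×N complex matrix of rank n, F(X) := X − (A·X)^{*3}, B an n×N matrix with ker B = ker A, C an N×n matrix with B·C = I_n, and f(x) := B·F(C·x). Let λ ∈ ℂ, λ ≠ 0, |λ| ≠ 1, and suppose K_λ : ℂ^N → ℂ^N is analytic with K_λ(0) = 0, K_λ′(0) = I_N, and λ·F(K_λ(X)) = K_λ(λ·X) for all X. Then the function k_λ : ℂ^n → ℂ^n defined by k_λ(x) := B·K_λ(C·x) is analytic, satisfies k_λ(0) = 0, k_λ′(0) = I_n, λ·f(k_λ(x)) = k_λ(λ·x) for all x ∈ ℂ^n, and moreover k_λ(B·X) = B·K_λ(X) for all X ∈ ℂ^N. If K_λ is a polynomial map, then k_λ is a polynomial map of degree at most the degree of K_λ.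 -/
open Matrix

noncomputable section

/-- A map `h : ℂ^a → ℂ^b` is a polynomial map of degree at most `d`. -/
def IsPolyMapDeg {a b : ℕ} (h : (Fin a → ℂ) → (Fin b → ℂ)) (d : ℕ) : Prop :=
  ∃ p : Fin b → MvPolynomial (Fin a) ℂ,
    (∀ i, (p i).totalDegree ≤ d) ∧ ∀ x i, h x i = MvPolynomial.eval x (p i)

open scoped Topology

/-- Two analytic curves through the origin with the same velocity there which both conjugate
`x ↦ lam • (x - B (M x)^{*3})` to `t ↦ lam * t` coincide. -/
theorem eq_of_conj_of_deriv_eq {m n : ℕ} (B : Matrix (Fin n) (Fin m) ℂ)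
    (M : Matrix (Fin m) (Fin n) ℂ) {lam : ℂ} (hlam0 : lam ≠ 0) (hlam1 : ‖lam‖ ≠ 1)
    {u w : ℂ → Fin n → ℂ} (hu : AnalyticOnNhd ℂ u Set.univ) (hw : AnalyticOnNhd ℂ w Set.univ)
    (hu0 : u 0 = 0) (hw0 : w 0 = 0) {v : Fin n → ℂ} (hu' : HasDerivAt u v 0)
    (hw' : HasDerivAt w v 0)
    (huc : ∀ t, lam • (u t - B.mulVec (cube3 (M.mulVec (u t)))) = u (lam * t))
    (hwc : ∀ t, lam • (w t - B.mulVec (cube3 (M.mulVec (w t)))) = w (lam * t)) :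
    u = w := by
  have hd : AnalyticOnNhd ℂ (fun t => u t - w t) Set.univ := fun t ht => (hu t ht).sub (hw t ht)
  have hd' : HasDerivAt (fun t => u t - w t) 0 0 := by
    rw [← sub_self v]
    exact hu'.sub hw'
  suffices h : ∀ᶠ t in 𝓝 (0 : ℂ), u t - w t = 0 by
    funext t
    exact sub_eq_zero.1 (hd.eqOn_zero_of_preconnected_of_eventuallyEq_zero isPreconnected_univ
      (Set.mem_univ 0) h (Set.mem_univ t))
  by_contra hne
  obtain ⟨N, e, he, he0, hde⟩ :=
    (hd 0 (Set.mem_univ 0)).exists_eventuallyEq_pow_smul_nonzero_iff.2 hne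
  simp only [sub_zero] at hde
  have huC : ContinuousAt u 0 := (hu 0 (Set.mem_univ 0)).continuousAt
  have hwC : ContinuousAt w 0 := (hw 0 (Set.mem_univ 0)).continuousAt
  have heC : ContinuousAt e 0 := he.continuousAt
  have hmul : Filter.Tendsto (fun t : ℂ => lam * t) (𝓝 0) (𝓝 0) :=
    Continuous.tendsto' (by fun_prop) _ _ (by simp)
  let r : ℂ → Fin n → ℂ := fun t => B.mulVec (fun i => M.mulVec (e t) i *
    (M.mulVec (u t) i ^ 2 + M.mulVec (u t) i * M.mulVec (w t) i + M.mulVec (w t) i ^ 2))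
  have hMC : ∀ {g : ℂ → Fin n → ℂ}, ContinuousAt g 0 → ContinuousAt (fun t => M.mulVec (g t)) 0 :=
    fun hg => (Continuous.matrix_mulVec continuous_const continuous_id).continuousAt.comp hg
  have hr : Filter.Tendsto r (𝓝 0) (𝓝 0) := by
    have hrC : ContinuousAt r 0 := by
      refine ContinuousAt.comp (g := fun x => B.mulVec x)
        (Continuous.matrix_mulVec continuous_const continuous_id).continuousAt ?_
      refine continuousAt_pi.2 fun i => ?_
      have h1 := continuousAt_pi.1 (hMC heC) i
      have h2 := continuousAt_pi.1 (hMC huC) i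
      have h3 := continuousAt_pi.1 (hMC hwC) i
      exact h1.mul (((h2.pow 2).add (h2.mul h3)).add (h3.pow 2))
    have hr0 : r 0 = 0 := by
      ext i
      simp [r, hu0, hw0, Matrix.mulVec, dotProduct]
    simpa [ContinuousAt, hr0] using hrC
  have key : ∀ᶠ t in 𝓝[≠] (0 : ℂ), lam • (e t - r t) = lam ^ N • e (lam * t) := by
    filter_upwards [hde.filter_mono nhdsWithin_le_nhds,
      (hmul.eventually hde).filter_mono nhdsWithin_le_nhds, self_mem_nhdsWithin] with t h1 h2 ht
    have ht0 : t ^ N ≠ 0 := pow_ne_zero _ ht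
    have hcube : B.mulVec (cube3 (M.mulVec (u t))) - B.mulVec (cube3 (M.mulVec (w t)))
        = t ^ N • r t := by
      rw [← Matrix.mulVec_sub, ← Matrix.mulVec_smul]
      congr 1
      ext i
      have h3 : M.mulVec (u t) i - M.mulVec (w t) i = t ^ N * M.mulVec (e t) i := by
        rw [← Pi.sub_apply, ← Matrix.mulVec_sub, h1, Matrix.mulVec_smul, Pi.smul_apply,
          smul_eq_mul]
      simp only [cube3, Pi.sub_apply, Pi.smul_apply, smul_eq_mul]
      rw [← mul_assoc, ← h3]
      ring
    refine smul_right_injective _ ht0 ?_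
    calc t ^ N • lam • (e t - r t) = lam • (t ^ N • e t - t ^ N • r t) := by
          rw [smul_comm, smul_sub]
      _ = u (lam * t) - w (lam * t) := by
          rw [← h1, ← hcube, ← huc, ← hwc, ← smul_sub]
          congr 1
          abel
      _ = t ^ N • lam ^ N • e (lam * t) := by
          rw [h2, mul_pow, mul_comm, mul_smul]
  have hlim : lam • e 0 = lam ^ N • e 0 := by
    have h1 : Filter.Tendsto (fun t => lam • (e t - r t)) (𝓝[≠] 0) (𝓝 (lam • e 0)) := by
      simpa using ((heC.tendsto.sub hr).const_smul lam).mono_left nhdsWithin_le_nhds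
    have h2 : Filter.Tendsto (fun t => lam ^ N • e (lam * t)) (𝓝[≠] 0) (𝓝 (lam ^ N • e 0)) :=
      ((heC.tendsto.comp hmul).const_smul (lam ^ N)).mono_left nhdsWithin_le_nhds
    exact tendsto_nhds_unique_of_eventuallyEq h1 h2 key
  have hpow : lam = lam ^ N := smul_left_injective ℂ he0 hlim
  match N, hde, hpow with
  | 0, hde, _ => exact he0 (by simpa [hu0, hw0] using hde.self_of_nhds.symm)
  | 1, hde, _ =>
    have h1 : HasDerivAt (fun t : ℂ => t ^ 1 • e t) (e 0) 0 := by
      have h2 := (hasDerivAt_pow 1 (0 : ℂ)).smul he.differentiableAt.hasDerivAt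
      rwa [show (0 : ℂ) ^ 1 • deriv e 0 + ((1 : ℕ) * (0 : ℂ) ^ (1 - 1)) • e 0 = e 0 by simp] at h2
    exact he0 ((h1.congr_of_eventuallyEq hde).unique hd')
  | N + 2, _, hpow =>
    have h1 : lam ^ (N + 1) = 1 := by
      refine mul_right_cancel₀ hlam0 ?_
      rw [← pow_succ, one_mul, ← hpow]
    have h2 : ‖lam‖ ^ (N + 1) = 1 := by rw [← norm_pow, h1, norm_one]
    exact hlam1 ((pow_eq_one_iff_of_nonneg (norm_nonneg _) N.succ_ne_zero).1 h2)

/-- Substituting polynomials of degree at most one does not increase the total degree. -/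
theorem totalDegree_bind₁_le_of_forall_le_one {σ τ R : Type*} [CommSemiring R]
    (q : σ → MvPolynomial τ R) (hq : ∀ i, (q i).totalDegree ≤ 1) (p : MvPolynomial σ R) :
    (MvPolynomial.bind₁ q p).totalDegree ≤ p.totalDegree := by
  rw [MvPolynomial.bind₁, MvPolynomial.aeval_def, MvPolynomial.eval₂_eq]
  refine MvPolynomial.totalDegree_finsetSum_le fun s hs => ?_
  refine (MvPolynomial.totalDegree_mul _ _).trans ?_
  rw [MvPolynomial.algebraMap_eq, MvPolynomial.totalDegree_C, zero_add]
  refine (MvPolynomial.totalDegree_finsetProd _ _).trans ?_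
  refine le_trans (Finset.sum_le_sum fun i _ => ?_) (MvPolynomial.le_totalDegree hs)
  exact (MvPolynomial.totalDegree_pow _ _).trans (by simpa using Nat.mul_le_mul_left (s i) (hq i))

/-- Composing a polynomial map with linear maps on both sides does not increase its degree. -/
theorem IsPolyMapDeg.mulVec_comp_mulVec {a b a' b' d : ℕ} {h : (Fin a → ℂ) → (Fin b → ℂ)}
    (hh : IsPolyMapDeg h d) (B : Matrix (Fin b') (Fin b) ℂ) (C : Matrix (Fin a) (Fin a') ℂ) :
    IsPolyMapDeg (fun x => B.mulVec (h (C.mulVec x))) d := by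
  obtain ⟨p, hp, hhp⟩ := hh
  let q : Fin a → MvPolynomial (Fin a') ℂ := fun l => ∑ j, MvPolynomial.C (C l j) * MvPolynomial.X j
  have hq : ∀ l, (q l).totalDegree ≤ 1 := fun l =>
    MvPolynomial.totalDegree_finsetSum_le fun j _ =>
      (MvPolynomial.totalDegree_mul _ _).trans (by simp)
  refine ⟨fun i => ∑ j, MvPolynomial.C (B i j) * MvPolynomial.bind₁ q (p j), fun i => ?_,
    fun x i => ?_⟩
  · refine MvPolynomial.totalDegree_finsetSum_le fun j _ =>
      (MvPolynomial.totalDegree_mul _ _).trans ?_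
    rw [MvPolynomial.totalDegree_C, zero_add]
    exact (totalDegree_bind₁_le_of_forall_le_one q hq _).trans (hp j)
  · have hqx : (fun l => MvPolynomial.eval x (q l)) = C.mulVec x := by
      ext l
      simp [q, Matrix.mulVec, dotProduct]
    simp only [Matrix.mulVec, dotProduct, map_sum, map_mul, MvPolynomial.eval_C]
    refine Finset.sum_congr rfl fun j _ => ?_
    rw [hhp]
    congr 1
    exact (congrArg (fun y => MvPolynomial.eval y (p j)) hqx.symm).trans
      (MvPolynomial.eval₂Hom_bind₁ (RingHom.id ℂ) x q (p j)).symm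

/-- From a global pre-conjugation `K_λ` of the cubic-linear map `F`, the
formula `k_λ(x) := B·K_λ(C·x)` produces a global pre-conjugation of the paired
map `f(x) := B·F(C·x)`, with moreover `k_λ(B·X) = B·K_λ(X)`; and if `K_λ` is a
polynomial map of degree at most `d`, so is `k_λ`. -/
theorem preconjugation_descends_to_paired_map (N n : ℕ) (hn : n < N)
    (A : Matrix (Fin N) (Fin N) ℂ) (hrank : A.rank = n)
    (F : (Fin N → ℂ) → (Fin N → ℂ))
    (hF : ∀ X, F X = X - cube3 (A.mulVec X))
    (B : Matrix (Fin n) (Fin N) ℂ)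
    (hker : LinearMap.ker B.mulVecLin = LinearMap.ker A.mulVecLin)
    (C : Matrix (Fin N) (Fin n) ℂ) (hC : B * C = 1)
    (f : (Fin n → ℂ) → (Fin n → ℂ))
    (hf : ∀ x, f x = B.mulVec (F (C.mulVec x)))
    (lam : ℂ) (hlam0 : lam ≠ 0) (hlam1 : ‖lam‖ ≠ 1)
    (K : (Fin N → ℂ) → (Fin N → ℂ))
    (hKan : AnalyticOnNhd ℂ K Set.univ)
    (hK0 : K 0 = 0)
    (hK'0 : fderiv ℂ K 0 = ContinuousLinearMap.id ℂ (Fin N → ℂ))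
    (hKconj : ∀ X : Fin N → ℂ, lam • F (K X) = K (lam • X))
    (k : (Fin n → ℂ) → (Fin n → ℂ))
    (hk : ∀ x, k x = B.mulVec (K (C.mulVec x))) :
    AnalyticOnNhd ℂ k Set.univ ∧
    k 0 = 0 ∧
    fderiv ℂ k 0 = ContinuousLinearMap.id ℂ (Fin n → ℂ) ∧
    (∀ x : Fin n → ℂ, lam • f (k x) = k (lam • x)) ∧
    (∀ X : Fin N → ℂ, k (B.mulVec X) = B.mulVec (K X)) ∧
    (∀ d : ℕ, IsPolyMapDeg K d → IsPolyMapDeg k d) := by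
  let Bl : (Fin N → ℂ) →L[ℂ] (Fin n → ℂ) := LinearMap.toContinuousLinearMap B.mulVecLin
  let Cl : (Fin n → ℂ) →L[ℂ] (Fin N → ℂ) := LinearMap.toContinuousLinearMap C.mulVecLin
  have hBC : ∀ x, B.mulVec (C.mulVec x) = x := fun x => by simp [Matrix.mulVec_mulVec, hC]
  have hACB : ∀ Y, A.mulVec (C.mulVec (B.mulVec Y)) = A.mulVec Y := fun Y => by
    have h : C.mulVec (B.mulVec Y) - Y ∈ LinearMap.ker B.mulVecLin := by
      simp [Matrix.mulVec_sub, hBC, -Matrix.mulVec_mulVec]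
    rw [hker] at h
    simpa [Matrix.mulVec_sub, sub_eq_zero, -Matrix.mulVec_mulVec] using h
  have hBF : ∀ Y, B.mulVec (F Y)
      = B.mulVec Y - B.mulVec (cube3 ((A * C).mulVec (B.mulVec Y))) := fun Y => by
    rw [hF, Matrix.mulVec_sub, ← Matrix.mulVec_mulVec, hACB]
  have hK' : HasFDerivAt K (ContinuousLinearMap.id ℂ (Fin N → ℂ)) 0 := by
    rw [← hK'0]
    exact (hKan 0 (Set.mem_univ 0)).differentiableAt.hasFDerivAt
  have hkeq : k = Bl ∘ K ∘ Cl := funext hk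
  have hsemi : ∀ X : Fin N → ℂ, k (B.mulVec X) = B.mulVec (K X) := by
    intro X
    have curve : ∀ Y : Fin N → ℂ,
        AnalyticOnNhd ℂ (fun t : ℂ => B.mulVec (K (t • Y))) Set.univ ∧
        B.mulVec (K ((0 : ℂ) • Y)) = 0 ∧
        HasDerivAt (fun t : ℂ => B.mulVec (K (t • Y))) (B.mulVec Y) 0 ∧
        ∀ t : ℂ, lam • (B.mulVec (K (t • Y))
          - B.mulVec (cube3 ((A * C).mulVec (B.mulVec (K (t • Y))))))
          = B.mulVec (K ((lam * t) • Y)) := by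
      intro Y
      refine ⟨fun t _ => ?_, by simp [hK0], ?_, fun t => ?_⟩
      · exact (Bl.analyticAt _).comp ((hKan _ (Set.mem_univ _)).comp
          (analyticAt_id.smul analyticAt_const))
      · have h1 : HasDerivAt (fun t : ℂ => t • Y) Y 0 := by
          simpa using (hasDerivAt_id (0 : ℂ)).smul_const Y
        have h2 : HasFDerivAt K (ContinuousLinearMap.id ℂ (Fin N → ℂ)) ((0 : ℂ) • Y) := by
          simpa using hK'
        have h3 : HasDerivAt (fun t : ℂ => K (t • Y)) Y 0 :=
          HasFDerivAt.comp_hasDerivAt (f := fun t : ℂ => t • Y) (0 : ℂ) h2 h1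
        exact Bl.hasFDerivAt.comp_hasDerivAt (0 : ℂ) h3
      · rw [← hBF, ← Matrix.mulVec_smul, hKconj, mul_smul]
    obtain ⟨ha, h0, h', hc⟩ := curve X
    obtain ⟨ha₁, h0₁, h'₁, hc₁⟩ := curve (C.mulVec (B.mulVec X))
    rw [hBC] at h'₁
    have h := congrFun
      (eq_of_conj_of_deriv_eq B (A * C) hlam0 hlam1 ha₁ ha h0₁ h0 h'₁ h' hc₁ hc) 1
    simpa only [one_smul, ← hk] using h
  refine ⟨?_, ?_, ?_, fun x => ?_, hsemi, fun d hd => ?_⟩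
  · rw [hkeq]
    exact fun x _ => (Bl.analyticAt _).comp ((hKan _ (Set.mem_univ _)).comp (Cl.analyticAt x))
  · simp [hk, hK0]
  · have h1 : HasFDerivAt K (ContinuousLinearMap.id ℂ (Fin N → ℂ)) (Cl 0) := by simpa using hK'
    have h2 : HasFDerivAt k
        (Bl.comp ((ContinuousLinearMap.id ℂ (Fin N → ℂ)).comp Cl)) 0 := by
      rw [hkeq]
      exact Bl.hasFDerivAt.comp 0 (h1.comp 0 Cl.hasFDerivAt)
    rw [h2.fderiv]
    exact ContinuousLinearMap.ext hBC
  · have hfB : f (k x) = B.mulVec (F (K (C.mulVec x))) := by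
      rw [hf, hBF, hBF, hBC, hk]
    rw [hfB, ← Matrix.mulVec_smul, hKconj, hk, Matrix.mulVec_smul]
  · rw [show k = fun x => B.mulVec (K (C.mulVec x)) from funext hk]
    exact hd.mulVec_comp_mulVec B C
end
end

section
/- Let A be a singular N×N complex matrix of rank n, F(X) := X − (A·X)^{*3}, B an n×N matrix with ker B = ker A, C an N×n matrix with B·C = I_n, and f(x) := B·F(C·x). Let λ ∈ ℂ, λ ≠ 0, |λ| ≠ 1, and let K_λ : ℂ^N → ℂ^N be a global pre-conjugation of F (analytic, K_λ(0) = 0, K_λ′(0) = I_N, λ·F∘K_λ = K_λ∘(λ·id)), and set k_λ(x) := B·K_λ(C·x). If K_λ is injective, then k_λ is injective; if K_λ is surjective, then k_λ is surjective; and if K_λ is bijective, then k_λ is bijective with k_λ⁻¹(y) = B·K_λ⁻¹(C·y) for all y ∈ ℂ^n. -/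
open Matrix

noncomputable section

open Filter Topology

lemma cube3_add_smul_sub {m : ℕ} (a v : Fin m → ℂ) (s : ℂ) :
    cube3 (a + s • v) - cube3 a =
      s • ((3 * a ^ 2 + 3 * a * (s • v) + (s • v) ^ 2) * v) := by
  ext i
  simp [cube3]
  ring

/-- An analytic curve `e` with `e 0 = 0` and `e' 0 = 0` satisfying the linearised conjugation
equation along an analytic curve `a` with `a 0 = 0` vanishes near `0`. -/
lemma eventually_eq_zero_of_conj {N : ℕ} (A : Matrix (Fin N) (Fin N) ℂ) {lam : ℂ}
    (hlam0 : lam ≠ 0) (hlam1 : ‖lam‖ ≠ 1) {e a : ℂ → Fin N → ℂ}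
    (he : AnalyticAt ℂ e 0) (he0 : e 0 = 0) (he' : HasDerivAt e 0 0)
    (ha : ContinuousAt a 0) (ha0 : a 0 = 0)
    (hconj : ∀ t, e (lam * t) =
      lam • (e t - (cube3 (a t + A.mulVec (e t)) - cube3 (a t)))) :
    ∀ᶠ t in 𝓝 0, e t = 0 := by
  by_contra hne
  obtain ⟨m, g, hg, hg0, hge⟩ := he.exists_eventuallyEq_pow_smul_nonzero_iff.mpr hne
  simp only [sub_zero] at hge
  have hm0 : m ≠ 0 := by
    rintro rfl
    apply hg0
    simpa [he0] using hge.self_of_nhds.symm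
  have hm1 : m ≠ 1 := by
    rintro rfl
    apply hg0
    have h1 : HasDerivAt (fun t : ℂ => t ^ 1 • g t) (g 0) 0 := by
      simpa using ((hasDerivAt_id (0 : ℂ)).pow 1).fun_smul hg.differentiableAt.hasDerivAt
    exact h1.unique (he'.congr_of_eventuallyEq (hge.mono fun _ h => h.symm))
  have hmul : Tendsto (fun t : ℂ => lam * t) (𝓝 0) (𝓝 0) := by
    simpa using (continuous_const_mul lam).tendsto 0
  have hgc := hg.continuousAt
  let w : ℂ → Fin N → ℂ := fun t => A.mulVec (g t)
  have hA : Continuous (fun v : Fin N → ℂ => A.mulVec v) := by fun_prop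
  have hw : ContinuousAt w 0 := hA.continuousAt.comp hgc
  let R : ℂ → Fin N → ℂ := fun t =>
    lam • (g t - (3 * a t ^ 2 + 3 * a t * (t ^ m • w t) + (t ^ m • w t) ^ 2) * w t)
  have hR : Tendsto R (𝓝 0) (𝓝 (lam • g 0)) := by
    have : ContinuousAt R 0 := by fun_prop
    simpa [R, ContinuousAt, ha0, hm0] using this
  have hL : Tendsto (fun t => lam ^ m • g (lam * t)) (𝓝 0) (𝓝 (lam ^ m • g 0)) :=
    (hgc.tendsto.comp hmul).const_smul _
  have heq : ∀ᶠ t in 𝓝[≠] (0 : ℂ), lam ^ m • g (lam * t) = R t := by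
    filter_upwards [hge.filter_mono nhdsWithin_le_nhds,
      (hmul.eventually hge).filter_mono nhdsWithin_le_nhds, self_mem_nhdsWithin] with t h1 h2 ht
    have h3 := hconj t
    rw [h2, h1, Matrix.mulVec_smul, cube3_add_smul_sub, ← smul_sub, smul_comm lam, mul_pow,
      mul_comm (lam ^ m), mul_smul] at h3
    exact smul_right_injective _ (pow_ne_zero m ht) h3
  have hlim : lam ^ m • g 0 = lam • g 0 :=
    tendsto_nhds_unique (hL.mono_left nhdsWithin_le_nhds)
      ((hR.mono_left nhdsWithin_le_nhds).congr' (heq.mono fun _ h => h.symm))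
  have hpow : lam ^ m = lam := smul_left_injective ℂ hg0 hlim
  obtain ⟨j, rfl⟩ := Nat.exists_eq_succ_of_ne_zero hm0
  have hj : lam ^ j = 1 := by
    rw [pow_succ] at hpow
    exact mul_right_cancel₀ hlam0 (by rw [hpow, one_mul])
  refine hlam1 ((pow_eq_one_iff_of_nonneg (norm_nonneg lam) (n := j) ?_).mp ?_)
  · rintro rfl
    exact hm1 rfl
  · rw [← norm_pow, hj, norm_one]

/-- A global pre-conjugation of a cubic-linear map commutes with translations by `ker A`. -/
lemma preconjugation_add_of_mulVec_eq_zero {N : ℕ} (A : Matrix (Fin N) (Fin N) ℂ)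
    {lam : ℂ} (hlam0 : lam ≠ 0) (hlam1 : ‖lam‖ ≠ 1)
    {K : (Fin N → ℂ) → (Fin N → ℂ)} (hKan : AnalyticOnNhd ℂ K Set.univ) (hK0 : K 0 = 0)
    (hK'0 : fderiv ℂ K 0 = ContinuousLinearMap.id ℂ (Fin N → ℂ))
    (hKconj : ∀ X, lam • (K X - cube3 (A.mulVec (K X))) = K (lam • X))
    (X Z : Fin N → ℂ) (hZ : A.mulVec Z = 0) : K (X + Z) = K X + Z := by
  have hline : ∀ Y : Fin N → ℂ, AnalyticOnNhd ℂ (fun t : ℂ => K (t • Y)) Set.univ :=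
    fun Y t _ => AnalyticAt.fun_comp (f := fun t : ℂ => t • Y) (hKan (t • Y) trivial)
      (analyticAt_id.fun_smul analyticAt_const)
  have hderiv : ∀ Y : Fin N → ℂ, HasDerivAt (fun t : ℂ => K (t • Y)) Y 0 := by
    intro Y
    have hK : HasFDerivAt K (ContinuousLinearMap.id ℂ (Fin N → ℂ)) ((0 : ℂ) • Y) := by
      rw [zero_smul, ← hK'0]
      exact (hKan 0 trivial).differentiableAt.hasFDerivAt
    have hs : HasDerivAt (fun t : ℂ => t • Y) Y 0 := by
      simpa using (hasDerivAt_id (0 : ℂ)).smul_const Y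
    exact hK.comp_hasDerivAt 0 hs
  let e : ℂ → Fin N → ℂ := fun t => K (t • (X + Z)) - K (t • X) - t • Z
  have he : AnalyticOnNhd ℂ e Set.univ := fun t _ =>
    ((hline (X + Z) t trivial).sub (hline X t trivial)).sub (analyticAt_id.smul analyticAt_const)
  have he' : HasDerivAt e 0 0 := by
    have hs : HasDerivAt (fun t : ℂ => t • Z) Z 0 := by
      simpa using (hasDerivAt_id (0 : ℂ)).smul_const Z
    have h := ((hderiv (X + Z)).fun_sub (hderiv X)).fun_sub hs
    rwa [add_sub_cancel_left, sub_self] at h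
  have hA : Continuous (fun v : Fin N → ℂ => A.mulVec v) := by fun_prop
  have hzero : ∀ᶠ t in 𝓝 0, e t = 0 := by
    refine eventually_eq_zero_of_conj A hlam0 hlam1 (a := fun t => A.mulVec (K (t • X)))
      (he 0 trivial) (by simp [e, hK0]) he'
      (hA.continuousAt.comp (hline X 0 trivial).continuousAt) (by simp [hK0]) fun t => ?_
    have hsum : A.mulVec (K (t • X)) + A.mulVec (e t) = A.mulVec (K (t • (X + Z))) := by
      simp [e, Matrix.mulVec_sub, Matrix.mulVec_smul, hZ]
    rw [hsum]
    simp only [e, mul_smul, ← hKconj]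
    module
  have h1 : e 1 = 0 :=
    congrFun (he.eq_of_eventuallyEq (g := 0) analyticOnNhd_const hzero) 1
  simpa [e, sub_sub, sub_eq_zero] using h1

/-- If the global pre-conjugation `K_λ` of the cubic-linear map `F` is
injective (resp. surjective, bijective), then so is the induced pre-conjugation
`k_λ(x) := B·K_λ(C·x)` of the paired map `f`; when `K_λ` is bijective,
`k_λ⁻¹(y) = B·K_λ⁻¹(C·y)`. -/
theorem preconjugation_invertibility_descends (N n : ℕ) (hn : n < N)
    (A : Matrix (Fin N) (Fin N) ℂ) (hrank : A.rank = n)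
    (F : (Fin N → ℂ) → (Fin N → ℂ))
    (hF : ∀ X, F X = X - cube3 (A.mulVec X))
    (B : Matrix (Fin n) (Fin N) ℂ)
    (hker : LinearMap.ker B.mulVecLin = LinearMap.ker A.mulVecLin)
    (C : Matrix (Fin N) (Fin n) ℂ) (hC : B * C = 1)
    (f : (Fin n → ℂ) → (Fin n → ℂ))
    (hf : ∀ x, f x = B.mulVec (F (C.mulVec x)))
    (lam : ℂ) (hlam0 : lam ≠ 0) (hlam1 : ‖lam‖ ≠ 1)
    (K : (Fin N → ℂ) → (Fin N → ℂ))
    (hKan : AnalyticOnNhd ℂ K Set.univ)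
    (hK0 : K 0 = 0)
    (hK'0 : fderiv ℂ K 0 = ContinuousLinearMap.id ℂ (Fin N → ℂ))
    (hKconj : ∀ X : Fin N → ℂ, lam • F (K X) = K (lam • X))
    (k : (Fin n → ℂ) → (Fin n → ℂ))
    (hk : ∀ x, k x = B.mulVec (K (C.mulVec x))) :
    (Function.Injective K → Function.Injective k) ∧
    (Function.Surjective K → Function.Surjective k) ∧
    (Function.Bijective K → Function.Bijective k ∧
      ∀ y : Fin n → ℂ,
        Function.invFun k y = B.mulVec (Function.invFun K (C.mulVec y))) := by
  have hadd := preconjugation_add_of_mulVec_eq_zero A hlam0 hlam1 hKan hK0 hK'0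
    (fun X => by rw [← hF, hKconj])
  have hAB : ∀ Z, B.mulVec Z = 0 → A.mulVec Z = 0 := fun Z hZ => by
    have : Z ∈ LinearMap.ker B.mulVecLin := hZ
    rw [hker] at this
    exact this
  have hBC : ∀ x, B.mulVec (C.mulVec x) = x := fun x => by
    rw [Matrix.mulVec_mulVec, hC, Matrix.one_mulVec]
  have hsemi : ∀ X, k (B.mulVec X) = B.mulVec (K X) := by
    intro X
    have hX : B.mulVec (X - C.mulVec (B.mulVec X)) = 0 := by
      rw [Matrix.mulVec_sub, hBC, sub_self]
    have h := hadd (C.mulVec (B.mulVec X)) _ (hAB _ hX)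
    rw [add_sub_cancel] at h
    rw [hk, h, Matrix.mulVec_add, hX, add_zero]
  have hinj : Function.Injective K → Function.Injective k := by
    intro hK x y hxy
    rw [hk, hk, ← sub_eq_zero, ← Matrix.mulVec_sub] at hxy
    have h := hadd (C.mulVec y) _ (hAB _ hxy)
    rw [add_sub_cancel] at h
    have h' := congrArg B.mulVec (hK h)
    rw [Matrix.mulVec_add, hxy, add_zero, hBC, hBC] at h'
    exact h'.symm
  have hright : Function.Surjective K →
      ∀ y, k (B.mulVec (Function.invFun K (C.mulVec y))) = y := fun hK y => by
    rw [hsemi, Function.rightInverse_invFun hK, hBC]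
  have hsurj : Function.Surjective K → Function.Surjective k := fun hK y => ⟨_, hright hK y⟩
  refine ⟨hinj, hsurj, fun hK => ⟨⟨hinj hK.1, hsurj hK.2⟩, fun y => ?_⟩⟩
  apply hinj hK.1
  rw [Function.rightInverse_invFun (hsurj hK.2), hright hK.2]
end
end

section
/- Define f : ℂ⁵ → ℂ⁵ by f(x) = x + 3·(0, 0, x₁²x₂ + x₁x₂² + 2x₁x₂x₄ − 2x₁²x₅, −x₁²x₂ − x₁x₂² − 2x₁x₂x₃ − 2x₁²x₅, −x₂²x₃ − x₂²x₄). Then f is a bijection of ℂ⁵ whose inverse is the polynomial map of degree 7 given by f⁻¹(y) = y + 3·(0, 0, −y₁²y₂ − y₁y₂² − 2y₁y₂y₄ + 2y₁²y₅, y₁²y₂ + y₁y₂² + 2y₁y₂y₃ + 2y₁²y₅, y₂²y₃ + y₂²y₄) + 18·(0, 0, −y₁³y₂² − y₁²y₂³ − y₁²y₂²y₃ + y₁²y₂²y₄ − 2y₁³y₂y₅, −y₁³y₂² − y₁²y₂³ + y₁²y₂²y₃ − y₁²y₂²y₄ + 2y₁³y₂y₅, y₁y₂³y₃ − y₁y₂³y₄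 + 2y₁²y₂²y₅) + 108·(0, 0, y₁⁴y₂³ + y₁³y₂⁴, −y₁⁴y₂³ − y₁³y₂⁴, −y₁³y₂⁴ − y₁²y₂⁵). -/
noncomputable section

/-- The cubic-homogeneous map `f : ℂ⁵ → ℂ⁵` paired to Druzkowski's
15-dimensional cubic-linear example is a bijection of `ℂ⁵`, with the explicit
degree-7 polynomial inverse `g`. (Coordinates: `x 0, …, x 4` stand for
`x₁, …, x₅`.) -/
theorem druzkowski_paired_map_bijective_with_polynomial_inverse
    (f g : (Fin 5 → ℂ) → (Fin 5 → ℂ))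
    (hf : ∀ x : Fin 5 → ℂ, f x = x + (3 : ℂ) •
      ![0, 0,
        (x 0) ^ 2 * x 1 + x 0 * (x 1) ^ 2 + 2 * x 0 * x 1 * x 3
          - 2 * (x 0) ^ 2 * x 4,
        -(x 0) ^ 2 * x 1 - x 0 * (x 1) ^ 2 - 2 * x 0 * x 1 * x 2
          - 2 * (x 0) ^ 2 * x 4,
        -(x 1) ^ 2 * x 2 - (x 1) ^ 2 * x 3])
    (hg : ∀ y : Fin 5 → ℂ, g y = y + (3 : ℂ) •
      ![0, 0,
        -(y 0) ^ 2 * y 1 - y 0 * (y 1) ^ 2 - 2 * y 0 * y 1 * y 3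
          + 2 * (y 0) ^ 2 * y 4,
        (y 0) ^ 2 * y 1 + y 0 * (y 1) ^ 2 + 2 * y 0 * y 1 * y 2
          + 2 * (y 0) ^ 2 * y 4,
        (y 1) ^ 2 * y 2 + (y 1) ^ 2 * y 3]
      + (18 : ℂ) •
      ![0, 0,
        -(y 0) ^ 3 * (y 1) ^ 2 - (y 0) ^ 2 * (y 1) ^ 3
          - (y 0) ^ 2 * (y 1) ^ 2 * y 2 + (y 0) ^ 2 * (y 1) ^ 2 * y 3
          - 2 * (y 0) ^ 3 * y 1 * y 4,
        -(y 0) ^ 3 * (y 1) ^ 2 - (y 0) ^ 2 * (y 1) ^ 3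
          + (y 0) ^ 2 * (y 1) ^ 2 * y 2 - (y 0) ^ 2 * (y 1) ^ 2 * y 3
          + 2 * (y 0) ^ 3 * y 1 * y 4,
        y 0 * (y 1) ^ 3 * y 2 - y 0 * (y 1) ^ 3 * y 3
          + 2 * (y 0) ^ 2 * (y 1) ^ 2 * y 4]
      + (108 : ℂ) •
      ![0, 0,
        (y 0) ^ 4 * (y 1) ^ 3 + (y 0) ^ 3 * (y 1) ^ 4,
        -(y 0) ^ 4 * (y 1) ^ 3 - (y 0) ^ 3 * (y 1) ^ 4,
        -(y 0) ^ 3 * (y 1) ^ 4 - (y 0) ^ 2 * (y 1) ^ 5]) :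
    Function.Bijective f ∧
    Function.LeftInverse g f ∧ Function.RightInverse g f := by
  have left_inv : Function.LeftInverse g f := by
    intro x
    rw [hg, hf]
    ext i
    fin_cases i <;> simp [-add_eq_left, -Matrix.add_cons] <;> ring
  have right_inv : Function.RightInverse g f := by
    intro y
    rw [hf, hg]
    ext i
    fin_cases i <;> simp [-add_eq_left, -Matrix.add_cons] <;> ring
  exact ⟨⟨left_inv.injective, right_inv.surjective⟩, left_inv, right_inv⟩
end
end

section
/- Define f : ℂ⁴ → ℂ⁴ by f(x) = x + ((x₃x₁ + x₄x₂)·x₄, −(x₃x₁ + x₄x₂)·x₃, x₄³, 0). Then f is a bijection of ℂ⁴ whose inverse is the polynomial map of degree 7 given by f⁻¹(y) = y + (−y₁y₃y₄ − y₂y₄², y₁y₃² + y₂y₃y₄, −y₄³, 0) + (y₁y₄⁴, −2y₁y₃y₄³ − y₂y₄⁴, 0, 0) + (0, y₁y₄⁶, 0, 0). -/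
noncomputable section

/-- Van den Essen's cubic-homogeneous map `f : ℂ⁴ → ℂ⁴`,
`f(x) = x + ((x₃x₁ + x₄x₂)x₄, −(x₃x₁ + x₄x₂)x₃, x₄³, 0)`, is a bijection of
`ℂ⁴`, with the explicit degree-7 polynomial inverse `g`. (Coordinates:
`x 0, …, x 3` stand for `x₁, …, x₄`.) -/
theorem vanDenEssen_map_bijective_with_polynomial_inverse
    (f g : (Fin 4 → ℂ) → (Fin 4 → ℂ))
    (hf : ∀ x : Fin 4 → ℂ, f x = x +
      ![(x 2 * x 0 + x 3 * x 1) * x 3,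
        -(x 2 * x 0 + x 3 * x 1) * x 2,
        (x 3) ^ 3,
        0])
    (hg : ∀ y : Fin 4 → ℂ, g y = y +
      ![-(y 0) * y 2 * y 3 - y 1 * (y 3) ^ 2,
        y 0 * (y 2) ^ 2 + y 1 * y 2 * y 3,
        -(y 3) ^ 3,
        0]
      + ![y 0 * (y 3) ^ 4,
        -2 * y 0 * y 2 * (y 3) ^ 3 - y 1 * (y 3) ^ 4,
        0,
        0]
      + ![0, y 0 * (y 3) ^ 6, 0, 0]) :
    Function.Bijective f ∧
    Function.LeftInverse g f ∧ Function.RightInverse g f := by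
  have f0 (x) : f x 0 = x 0 + (x 2 * x 0 + x 3 * x 1) * x 3 := by simp [hf]
  have f1 (x) : f x 1 = x 1 - (x 2 * x 0 + x 3 * x 1) * x 2 := by simp [hf]; ring
  have f2 (x) : f x 2 = x 2 + x 3 ^ 3 := by simp [hf]
  have f3 (x) : f x 3 = x 3 := by simp [hf]
  have g0 (y) : g y 0 = y 0 - y 0 * y 2 * y 3 - y 1 * y 3 ^ 2 + y 0 * y 3 ^ 4 := by
    simp [hg, -Matrix.add_cons, -Matrix.cons_add]; ring
  have g1 (y) : g y 1 = y 1 + y 0 * y 2 ^ 2 + y 1 * y 2 * y 3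
      - 2 * y 0 * y 2 * y 3 ^ 3 - y 1 * y 3 ^ 4 + y 0 * y 3 ^ 6 := by
    simp [hg, -Matrix.add_cons, -Matrix.cons_add]; ring
  have g2 (y) : g y 2 = y 2 - y 3 ^ 3 := by simp [hg, -Matrix.add_cons, -Matrix.cons_add]; ring
  have g3 (y) : g y 3 = y 3 := by simp [hg, -Matrix.add_cons, -Matrix.cons_add]
  have h_left : Function.LeftInverse g f := by
    intro x
    ext i
    fin_cases i <;> simp only [Fin.zero_eta, Fin.mk_one, Fin.reduceFinMk, f0, f1, f2, f3,
      g0, g1, g2, g3] <;> ring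
  have h_right : Function.RightInverse g f := by
    intro y
    ext i
    fin_cases i <;> simp only [Fin.zero_eta, Fin.mk_one, Fin.reduceFinMk, f0, f1, f2, f3,
      g0, g1, g2, g3] <;> ring
  exact ⟨⟨h_left.injective, h_right.surjective⟩, h_left, h_right⟩
end
end
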